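/- arXiv:math/0304173 — 3 statements merged into one kernel-verified Lean document; each statement's English description precedes it below -/
import Mathlib

section
/- For any Hopf algebra H over k, the Hopf-adjoint action h▸x := Σ h₍₁₎ · x · S(h₍₂₎) makes H an H-module algebra, and the linear map γ : H#H → H ⊗ H given by x ⊗ h ↦ Σ x·h₍₁₎ ⊗ h₍₂₎ is an isomorphism of k-algebras from the resulting smash product H#H onto the tensor-product algebra H ⊗ H, with inverse x ⊗ h ↦ Σ x·S(h₍₁₎) ⊗ h₍₂₎. (Cross-product construction, part (iii).) -/
/-!
# Statement 5

Let `k` be a field and `H` a Hopf algebra over `k` with comultiplication `Δ`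
(Sweedler notation `Δ(h) = Σ h₍₁₎ ⊗ h₍₂₎`), counit `ε` and antipode `S`.

The Hopf-adjoint action of `H` on itself is `h ▸ x := Σ h₍₁₎ · x · S(h₍₂₎)`
(the bilinear map `ad` below).  The smash (cross) product `H # H` is the vector
space `H ⊗[k] H` equipped with the multiplication
`(x ⊗ h)(y ⊗ g) := Σ x·(h₍₁₎ ▸ y) ⊗ h₍₂₎·g` (the bilinear map `smashMul`
below), while the tensor-product algebra `H ⊗ H` carries the componentwise
multiplication (Mathlib's ring structure on `H ⊗[k] H`).

**Statement** (cross-product construction, part (iii)): the Hopf-adjoint action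
makes `H` an `H`-module algebra, and the linear map
`γ : H # H → H ⊗ H`, `x ⊗ h ↦ Σ x·h₍₁₎ ⊗ h₍₂₎` is an isomorphism of
`k`-algebras from the smash product onto the tensor-product algebra, with
inverse `δ : x ⊗ h ↦ Σ x·S(h₍₁₎) ⊗ h₍₂₎`.
-/

open TensorProduct

namespace Stmt5

variable {k H : Type*} [Field k] [Ring H] [HopfAlgebra k H]

/-- The Hopf-adjoint action of `H` on itself: `ad h x = Σ h₍₁₎ · x · S(h₍₂₎)`. -/
noncomputable def ad (k H : Type*) [Field k] [Ring H] [HopfAlgebra k H] :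
    H →ₗ[k] H →ₗ[k] H :=
  (TensorProduct.lift (LinearMap.mk₂ k
      (fun h₁ h₂ => (LinearMap.mul k H h₁) ∘ₗ
        ((LinearMap.mul k H).flip (HopfAlgebra.antipode (R := k) h₂)))
      (fun u u' v => by simp [LinearMap.add_comp])
      (fun c u v => by simp [LinearMap.smul_comp])
      (fun u v v' => by simp [LinearMap.comp_add])
      (fun c u v => by simp [LinearMap.comp_smul]))).comp
    (Coalgebra.comul (R := k))

/-- For `h : H`, the map `y ⊗ g ↦ Σ (h₍₁₎ ▸ y) ⊗ (h₍₂₎ · g)` on `H ⊗[k] H`,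
where `▸` is the Hopf-adjoint action. -/
noncomputable def smashRight (k H : Type*) [Field k] [Ring H] [HopfAlgebra k H] :
    H →ₗ[k] ((H ⊗[k] H) →ₗ[k] (H ⊗[k] H)) :=
  (TensorProduct.lift (LinearMap.mk₂ k
      (fun h₁ h₂ => TensorProduct.map (ad k H h₁) (LinearMap.mul k H h₂))
      (fun u u' v => by simp [TensorProduct.map_add_left])
      (fun c u v => by simp [TensorProduct.map_smul_left])
      (fun u v v' => by simp [TensorProduct.map_add_right])
      (fun c u v => by simp [TensorProduct.map_smul_right]))).comp
    (Coalgebra.comul (R := k))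

/-- The smash-product multiplication on `H ⊗[k] H` for the Hopf-adjoint action:
`(x ⊗ h)(y ⊗ g) = Σ x·(h₍₁₎ ▸ y) ⊗ h₍₂₎·g`. -/
noncomputable def smashMul (k H : Type*) [Field k] [Ring H] [HopfAlgebra k H] :
    (H ⊗[k] H) →ₗ[k] (H ⊗[k] H) →ₗ[k] (H ⊗[k] H) :=
  TensorProduct.lift (LinearMap.mk₂ k
    (fun x h => (TensorProduct.map (LinearMap.mul k H x) LinearMap.id) ∘ₗ smashRight k H h)
    (fun r r' h => by simp [TensorProduct.map_add_left, LinearMap.add_comp])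
    (fun c r h => by simp [TensorProduct.map_smul_left, LinearMap.smul_comp])
    (fun r h h' => by simp [LinearMap.comp_add])
    (fun c r h => by simp [LinearMap.comp_smul]))

/-- The map `γ : H # H → H ⊗ H`, `x ⊗ h ↦ Σ x·h₍₁₎ ⊗ h₍₂₎`. -/
noncomputable def gamma (k H : Type*) [Field k] [Ring H] [HopfAlgebra k H] :
    (H ⊗[k] H) →ₗ[k] (H ⊗[k] H) :=
  TensorProduct.lift (LinearMap.mk₂ k
    (fun x h => TensorProduct.map (LinearMap.mul k H x) LinearMap.id
      (Coalgebra.comul (R := k) h))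
    (fun x x' h => by simp [TensorProduct.map_add_left])
    (fun c x h => by simp [TensorProduct.map_smul_left])
    (fun x h h' => by simp)
    (fun c x h => by simp))

/-- The map `δ : H ⊗ H → H # H`, `x ⊗ h ↦ Σ x·S(h₍₁₎) ⊗ h₍₂₎`. -/
noncomputable def delta (k H : Type*) [Field k] [Ring H] [HopfAlgebra k H] :
    (H ⊗[k] H) →ₗ[k] (H ⊗[k] H) :=
  TensorProduct.lift (LinearMap.mk₂ k
    (fun x h => TensorProduct.map
      ((LinearMap.mul k H x) ∘ₗ HopfAlgebra.antipode (R := k)) LinearMap.id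
      (Coalgebra.comul (R := k) h))
    (fun x x' h => by simp [LinearMap.add_comp, TensorProduct.map_add_left])
    (fun c x h => by simp [LinearMap.smul_comp, TensorProduct.map_smul_left])
    (fun x h h' => by simp)
    (fun c x h => by simp))

open Coalgebra HopfAlgebra WithConv Algebra.TensorProduct

section AdjointAction

variable {ι : Type*}

lemma ad_apply_repr {h : H} (r : Repr k h ι) (x : H) :
    ad k H h x = ∑ i ∈ r.index, r.left i * (x * antipode k (r.right i)) := by
  simp [ad, ← r.eq]

/-- The orbit map `h ↦ h ▸ y` is the convolution of `h ↦ h * y` and the antipode. -/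
lemma toConv_ad_flip (y : H) :
    toConv ((ad k H).flip y) =
      toConv ((LinearMap.mul k H).flip y) * toConv (antipode k (A := H)) := by
  ext h
  rw [(ℛ k h).convMul_apply]
  simp [ad_apply_repr (ℛ k h), mul_assoc]

/-- In Sweedler notation, `Σ (h₍₁₎ ▸ y) * h₍₂₎ = h * y`. -/
lemma toConv_ad_flip_mul_id (y : H) :
    toConv ((ad k H).flip y) * toConv LinearMap.id = toConv ((LinearMap.mul k H).flip y) := by
  rw [toConv_ad_flip, mul_assoc, LinearMap.antipode_mul_id, mul_one]

lemma toConv_mul_flip_mul (x y : H) :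
    toConv ((LinearMap.mul k H).flip (x * y)) =
      toConv ((ad k H).flip x) * toConv ((LinearMap.mul k H).flip y) := by
  ext h
  have := congr($(toConv_ad_flip_mul_id (k := k) x) h * y)
  rw [(ℛ k h).convMul_apply] at this ⊢
  simpa [Finset.sum_mul, mul_assoc] using this.symm

lemma toConv_ad_flip_mul (x y : H) :
    toConv ((ad k H).flip (x * y)) =
      toConv ((ad k H).flip x) * toConv ((ad k H).flip y) := by
  rw [toConv_ad_flip, toConv_mul_flip_mul, mul_assoc, ← toConv_ad_flip]

lemma ad_one : ad k H 1 = LinearMap.id := by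
  ext x
  simp [ad, Algebra.TensorProduct.one_def]

lemma ad_mul (u v : H) : ad k H (u * v) = ad k H u ∘ₗ ad k H v := by
  ext x
  simp only [LinearMap.comp_apply, ad_apply_repr (ℛ k v), ad_apply_repr (ℛ k u),
    ad_apply_repr ((ℛ k u).mul (ℛ k v))]
  simp [Finset.sum_product, antipode_mul_antidistrib, Finset.mul_sum, Finset.sum_mul, mul_assoc]

lemma ad_apply_one (h : H) : ad k H h 1 = counit (R := k) h • (1 : H) := by
  simp [ad_apply_repr (ℛ k h), sum_mul_antipode_eq_smul (ℛ k h)]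

end AdjointAction

section Twist

/-- The left factor inclusion, precomposed with `f`, as an element of the convolution algebra. -/
noncomputable def convLeft (f : H →ₗ[k] H) : WithConv (H →ₗ[k] H ⊗[k] H) :=
  toConv ((includeLeft : H →ₐ[k] H ⊗[k] H).toLinearMap ∘ₗ f)

/-- The right factor inclusion as an element of the convolution algebra. -/
noncomputable def convRight (k H : Type*) [Field k] [Ring H] [HopfAlgebra k H] :
    WithConv (H →ₗ[k] H ⊗[k] H) :=
  toConv (includeRight : H →ₐ[k] H ⊗[k] H).toLinearMap

lemma convLeft_mul (f g : H →ₗ[k] H) :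
    convLeft f * convLeft g = convLeft (toConv f * toConv g).ofConv := by
  simp only [convLeft, LinearMap.algHom_comp_convMul_distrib, toConv_ofConv]

lemma convLeft_one : convLeft (1 : WithConv (H →ₗ[k] H)).ofConv = 1 := by
  ext h
  simp [convLeft, LinearMap.convOne_def]

lemma convLeft_mul_convRight_apply (f : H →ₗ[k] H) (h : H) :
    (convLeft f * convRight k H) h = TensorProduct.map f LinearMap.id (comul (R := k) h) := by
  rw [(ℛ k h).convMul_apply, ← (ℛ k h).eq]
  simp [convLeft, convRight]

lemma convLeft_id_mul_convRight :
    convLeft LinearMap.id * convRight k H = toConv (comul (R := k)) := by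
  ext h
  simp [-LinearMap.convMul_apply, convLeft_mul_convRight_apply]

lemma map_mul_left_id (x : H) (p : H ⊗[k] H) :
    TensorProduct.map (LinearMap.mul k H x) LinearMap.id p = (x ⊗ₜ[k] (1 : H)) * p := by
  induction p with
  | zero => simp
  | add p q hp hq => simp [mul_add, hp, hq]
  | tmul a b => simp

lemma gamma_tmul (x h : H) :
    gamma k H (x ⊗ₜ h) = (x ⊗ₜ[k] (1 : H)) * comul (R := k) h := by
  simp [gamma, map_mul_left_id]

lemma delta_tmul (x h : H) :
    delta k H (x ⊗ₜ h) =
      (x ⊗ₜ[k] (1 : H)) * (convLeft (antipode k) * convRight k H : WithConv (H →ₗ[k] H ⊗[k] H)) h := by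
  rw [convLeft_mul_convRight_apply, ← map_mul_left_id,
    ← LinearMap.comp_apply (TensorProduct.map _ _), ← TensorProduct.map_comp]
  simp [delta]

lemma gamma_tmul_one_mul (x : H) (p : H ⊗[k] H) :
    gamma k H ((x ⊗ₜ[k] (1 : H)) * p) = (x ⊗ₜ[k] (1 : H)) * gamma k H p := by
  induction p with
  | zero => simp
  | add p q hp hq => simp [mul_add, hp, hq]
  | tmul a b => simp [gamma_tmul, ← mul_assoc]

lemma delta_tmul_one_mul (x : H) (p : H ⊗[k] H) :
    delta k H ((x ⊗ₜ[k] (1 : H)) * p) = (x ⊗ₜ[k] (1 : H)) * delta k H p := by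
  induction p with
  | zero => simp
  | add p q hp hq => simp [mul_add, hp, hq]
  | tmul a b => simp [delta_tmul, ← mul_assoc]

lemma delta_comul (h : H) : delta k H (comul (R := k) h) = (1 : H) ⊗ₜ[k] h := by
  have key : convLeft LinearMap.id * (convLeft (antipode k) * convRight k H) = convRight k H := by
    rw [← mul_assoc, convLeft_mul, LinearMap.id_mul_antipode, convLeft_one, one_mul]
  have := congr($key h)
  rw [(ℛ k h).convMul_apply] at this
  rw [← (ℛ k h).eq, map_sum]
  simpa [delta_tmul, convLeft, convRight] using this

lemma gamma_convLeft_antipode (h : H) :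
    gamma k H ((convLeft (antipode k) * convRight k H : WithConv (H →ₗ[k] H ⊗[k] H)) h) = (1 : H) ⊗ₜ[k] h := by
  have key : convLeft (antipode k) * toConv (comul (R := k)) = convRight k H := by
    rw [← convLeft_id_mul_convRight, ← mul_assoc, convLeft_mul, LinearMap.antipode_mul_id,
      convLeft_one, one_mul]
  have := congr($key h)
  rw [(ℛ k h).convMul_apply] at this ⊢
  simpa [gamma_tmul, convLeft, convRight] using this

lemma delta_comp_gamma : delta k H ∘ₗ gamma k H = LinearMap.id := by
  ext x h
  simp [gamma_tmul, delta_tmul_one_mul, delta_comul]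

lemma gamma_comp_delta : gamma k H ∘ₗ delta k H = LinearMap.id := by
  ext x h
  simp [-LinearMap.convMul_apply, delta_tmul, gamma_tmul_one_mul, gamma_convLeft_antipode]

/-- In Sweedler notation, `Σ ((h₍₁₎ ▸ y) ⊗ 1) * Δ h₍₂₎ = Δ h * (y ⊗ 1)`. -/
lemma convLeft_ad_flip_mul_comul_apply (h y : H) :
    (convLeft ((ad k H).flip y) * toConv (comul (R := k)) : WithConv (H →ₗ[k] H ⊗[k] H)) h =
      comul (R := k) h * (y ⊗ₜ[k] (1 : H)) := by
  rw [← convLeft_id_mul_convRight, ← mul_assoc, convLeft_mul, toConv_ad_flip_mul_id,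
    convLeft_mul_convRight_apply, ← (ℛ k h).eq]
  simp [Finset.sum_mul]

lemma gamma_smashRight (h y g : H) :
    gamma k H (smashRight k H h (y ⊗ₜ g)) = comul (R := k) h * gamma k H (y ⊗ₜ g) := by
  rw [gamma_tmul, ← mul_assoc, ← convLeft_ad_flip_mul_comul_apply, (ℛ k h).convMul_apply]
  simp [smashRight, ← (ℛ k h).eq, gamma_tmul, convLeft, Finset.sum_mul, mul_assoc]

lemma gamma_smashMul (p q : H ⊗[k] H) :
    gamma k H (smashMul k H p q) = gamma k H p * gamma k H q := by
  induction p with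
  | zero => simp
  | add p p' hp hp' => simp [add_mul, hp, hp']
  | tmul x h =>
    induction q with
    | zero => simp
    | add q q' hq hq' => simp only [map_add, mul_add, hq, hq']
    | tmul y g =>
      rw [gamma_tmul, mul_assoc, ← gamma_smashRight, ← gamma_tmul_one_mul, ← map_mul_left_id]
      simp [smashMul]

end Twist

/-- cross-product construction, part (iii).  The Hopf-adjoint
action `h ▸ x = Σ h₍₁₎ · x · S(h₍₂₎)` makes `H` an `H`-module algebra, and
`γ : x ⊗ h ↦ Σ x·h₍₁₎ ⊗ h₍₂₎` is an isomorphism of `k`-algebras from the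
resulting smash product `H # H` onto the tensor-product algebra `H ⊗ H`
(with componentwise multiplication), with inverse
`δ : x ⊗ h ↦ Σ x·S(h₍₁₎) ⊗ h₍₂₎`. -/
theorem statement5 :
    -- `ad` is an `H`-module structure on `H` ...
    (ad k H 1 = LinearMap.id) ∧
    (∀ u v : H, ad k H (u * v) = ad k H u ∘ₗ ad k H v) ∧
    -- ... which makes `H` an `H`-module algebra:
    (∀ h x y : H, ad k H h (x * y) =
      LinearMap.mul' k H
        (TensorProduct.map ((ad k H).flip x) ((ad k H).flip y)
          (Coalgebra.comul (R := k) h))) ∧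
    (∀ h : H, ad k H h (1 : H) = Coalgebra.counit (R := k) h • (1 : H)) ∧
    -- `γ` is a homomorphism of `k`-algebras from `H # H` to `H ⊗ H` ...
    (∀ p q : H ⊗[k] H, gamma k H (smashMul k H p q) = gamma k H p * gamma k H q) ∧
    (gamma k H ((1 : H) ⊗ₜ[k] (1 : H)) = 1) ∧
    -- ... which is bijective, with inverse `δ`:
    (delta k H ∘ₗ gamma k H = LinearMap.id) ∧
    (gamma k H ∘ₗ delta k H = LinearMap.id) := by
  refine ⟨ad_one, ad_mul, fun h x y => ?_, ad_apply_one, gamma_smashMul, ?_,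
    delta_comp_gamma, gamma_comp_delta⟩
  · exact congr($(toConv_ad_flip_mul (k := k) x y) h)
  · rw [gamma_tmul, Bialgebra.comul_one, mul_one, Algebra.TensorProduct.one_def]

end Stmt5
end

section
/- Let i : D → D' be a triangulated (exact) functor between triangulated categories and let S be a set of objects of D such that: (a) the smallest strictly full triangulated subcategory of D containing S is D itself, and the smallest strictly full triangulated subcategory of D' containing all objects i(M), M ∈ S, is D' itself; and (b) for all M₁, M₂ ∈ S and all k ∈ ℤ, the map Hom_D(M₁, M₂[k]) → Hom_{D'}(i(M₁), i(M₂)[k]) induced by i is bijective. Then i is an equivalence of triangulated categories. -/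
/-!
# Statement 6

Let `i : D → D'` be a triangulated (exact) functor between triangulated
categories, i.e. a functor commuting with the shifts (`i.CommShift ℤ`) and
sending distinguished triangles to distinguished triangles
(`i.IsTriangulated`), and let `S` be a set of objects of `D` such that:

(a) the smallest strictly full triangulated subcategory of `D` containing `S`
is `D` itself, and the smallest strictly full triangulated subcategory of `D'`
containing all the objects `i(M)`, `M ∈ S`, is `D'` itself — a strictly full
triangulated subcategory being a class of objects closed under isomorphisms,
shifts in both directions, and cones of morphisms (the predicate
`IsStrictlyFullTriangulatedSub` below); and

(b) for all `M₁, M₂ ∈ S` and all `n ∈ ℤ`, the map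
`Hom_D(M₁, M₂[n]) → Hom_{D'}(i M₁, (i M₂)[n])` induced by `i` is bijective.

Then `i` is an equivalence of (triangulated) categories.
-/

open CategoryTheory CategoryTheory.Limits CategoryTheory.Pretriangulated

namespace CategoryTheory.Functor

variable {C D : Type*} [Category C] [Category D] (F : C ⥤ D)

/-- `F` induces a bijection `(X ⟶ Y) → (F.obj X ⟶ F.obj Y)`. -/
def BijectiveOnHom (X Y : C) : Prop :=
  Function.Bijective (fun f : X ⟶ Y => F.map f)

variable {F}

lemma BijectiveOnHom.of_iso {X X' Y Y' : C} (h : BijectiveOnHom F X Y) (e : X ≅ X')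
    (e' : Y ≅ Y') : BijectiveOnHom F X' Y' := by
  have := ((F.mapIso e).homCongr (F.mapIso e')).bijective.comp
    (h.comp (e.homCongr e').symm.bijective)
  rw [BijectiveOnHom]
  convert this using 2 with f
  simp [Iso.homCongr]

variable [HasShift C ℤ] [HasShift D ℤ] [F.CommShift ℤ]

lemma bijectiveOnHom_shift_iff (X Y : C) (n : ℤ) :
    BijectiveOnHom F X (Y⟦n⟧) ↔
      Function.Bijective (fun f : X ⟶ Y⟦n⟧ => F.map f ≫ (F.commShiftIso n).hom.app Y) :=
  (Function.Bijective.of_comp_iff'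
    (((F.commShiftIso n).app Y).homToEquiv (Z := F.obj X)).bijective _).symm

lemma BijectiveOnHom.shift {X Y : C} (h : BijectiveOnHom F X Y) (n : ℤ) :
    BijectiveOnHom F (X⟦n⟧) (Y⟦n⟧) := by
  have h₁ : Function.Bijective (fun f : X ⟶ Y => f⟦n⟧') :=
    (Functor.FullyFaithful.ofFullyFaithful (shiftFunctor C n)).map_bijective _ _
  have h₂ : Function.Bijective (fun f : F.obj X ⟶ F.obj Y => f⟦n⟧') :=
    (Functor.FullyFaithful.ofFullyFaithful (shiftFunctor D n)).map_bijective _ _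
  rw [BijectiveOnHom, ← Function.Bijective.of_comp_iff _ h₁]
  let e (Z : C) : (F.obj Z)⟦n⟧ ≅ F.obj (Z⟦n⟧) := ((F.commShiftIso n).app Z).symm
  have := ((e X).homCongr (e Y)).bijective.comp (h₂.comp h)
  convert this using 1
  funext f
  simp [e, Iso.homCongr]

end CategoryTheory.Functor

namespace Stmt6

variable (C : Type*) [Category C] [HasZeroObject C] [HasShift C ℤ] [Preadditive C]
  [∀ n : ℤ, (shiftFunctor C n).Additive] [Pretriangulated C]

/-- `P` is the class of objects of a strictly full triangulated subcategory:
it is closed under isomorphisms, under the shifts in both directions, and under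
cones of morphisms (for every distinguished triangle `X ⟶ Y ⟶ Z ⟶ X⟦1⟧`, if
`X` and `Y` satisfy `P` then so does the cone `Z`). -/
def IsStrictlyFullTriangulatedSub (P : C → Prop) : Prop :=
  (∀ ⦃X Y : C⦄, (X ≅ Y) → P X → P Y) ∧
  (∀ (X : C) (n : ℤ), P X → P (X⟦n⟧)) ∧
  (∀ T : Triangle C, (T ∈ distTriang C) → P T.obj₁ → P T.obj₂ → P T.obj₃)

variable {C}
variable {D : Type*} [Category D] [HasZeroObject D] [HasShift D ℤ] [Preadditive D]
  [∀ n : ℤ, (shiftFunctor D n).Additive] [Pretriangulated D]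

section FullyFaithfulOnPairs

open Functor

variable {F : C ⥤ D} [F.CommShift ℤ] [F.IsTriangulated]

lemma bijectiveOnHom_obj₃_right {A : C} {T : Triangle C} (hT : T ∈ distTriang C)
    (h₁ : BijectiveOnHom F A T.obj₁) (h₂ : BijectiveOnHom F A T.obj₂)
    (h₁' : BijectiveOnHom F A (T.obj₁⟦(1 : ℤ)⟧)) (h₂' : BijectiveOnHom F A (T.obj₂⟦(1 : ℤ)⟧)) :
    BijectiveOnHom F A T.obj₃ := by
  have hFT := F.map_distinguished T hT
  constructor
  · change Function.Injective (F.mapAddHom (X := A) (Y := T.obj₃))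
    rw [injective_iff_map_eq_zero]
    intro f (hf : F.map f = 0)
    obtain ⟨g, rfl⟩ := T.coyoneda_exact₃ hT f (h₁'.1 (by simp [hf]))
    obtain ⟨h', hh'⟩ : ∃ h' : F.obj A ⟶ F.obj T.obj₁, F.map g = h' ≫ F.map T.mor₁ :=
      Triangle.coyoneda_exact₂ _ hFT (F.map g)
        (show F.map g ≫ F.map T.mor₂ = 0 by simpa using hf)
    obtain ⟨h, rfl⟩ := h₁.2 h'
    obtain rfl : g = h ≫ T.mor₁ := h₂.1 (by simpa using hh')
    simp [comp_distTriang_mor_zero₁₂ _ hT]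
  · intro f
    obtain ⟨k, hk⟩ := h₁'.2 (f ≫ F.map T.mor₃)
    dsimp at hk
    have hk₀ : k ≫ T.mor₁⟦1⟧' = 0 := h₂'.1 (by
      have h₃₁ := F.congr_map (comp_distTriang_mor_zero₃₁ _ hT)
      simp only [Functor.map_comp, Functor.map_zero] at h₃₁
      simp [hk, h₃₁])
    obtain ⟨g, rfl⟩ := T.coyoneda_exact₁ hT k hk₀
    obtain ⟨h', hh'⟩ : ∃ h' : F.obj A ⟶ F.obj T.obj₂, f - F.map g = h' ≫ F.map T.mor₂ :=
      Triangle.coyoneda_exact₃ _ hFT (f - F.map g)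
        (show (f - F.map g) ≫ F.map T.mor₃ ≫ (F.commShiftIso (1 : ℤ)).hom.app T.obj₁ = 0 by
          rw [Functor.map_comp] at hk
          simp [Preadditive.sub_comp, reassoc_of% hk])
    obtain ⟨h, rfl⟩ := h₂.2 h'
    refine ⟨g + h ≫ T.mor₂, ?_⟩
    dsimp at hh' ⊢
    rw [F.map_add, F.map_comp, ← hh']
    abel

lemma bijectiveOnHom_obj₃_left {A : C} {T : Triangle C} (hT : T ∈ distTriang C)
    (h₁ : BijectiveOnHom F T.obj₁ A) (h₂ : BijectiveOnHom F T.obj₂ A)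
    (h₁' : BijectiveOnHom F (T.obj₁⟦(1 : ℤ)⟧) A) (h₂' : BijectiveOnHom F (T.obj₂⟦(1 : ℤ)⟧) A) :
    BijectiveOnHom F T.obj₃ A := by
  have hFT := F.map_distinguished T hT
  constructor
  · change Function.Injective (F.mapAddHom (X := T.obj₃) (Y := A))
    rw [injective_iff_map_eq_zero]
    intro f (hf : F.map f = 0)
    obtain ⟨g, rfl⟩ := T.yoneda_exact₃ hT f (h₂.1 (by simp [hf]))
    obtain ⟨h', hh'⟩ : ∃ h' : (F.obj T.obj₂)⟦(1 : ℤ)⟧ ⟶ F.obj A,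
        (F.commShiftIso (1 : ℤ)).inv.app T.obj₁ ≫ F.map g = (-(F.map T.mor₁)⟦1⟧') ≫ h' :=
      Triangle.yoneda_exact₃ _ (rot_of_distTriang _ hFT)
        ((F.commShiftIso (1 : ℤ)).inv.app T.obj₁ ≫ F.map g)
        (show (F.map T.mor₃ ≫ (F.commShiftIso (1 : ℤ)).hom.app T.obj₁) ≫
          (F.commShiftIso (1 : ℤ)).inv.app T.obj₁ ≫ F.map g = 0 by simpa using hf)
    obtain ⟨h, hh⟩ := h₂'.2 ((F.commShiftIso (1 : ℤ)).hom.app T.obj₂ ≫ h')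
    dsimp at hh
    obtain rfl : g = -(T.mor₁⟦1⟧' ≫ h) := h₁'.1 (by
      rw [← cancel_epi ((F.commShiftIso (1 : ℤ)).inv.app T.obj₁)]
      dsimp only
      rw [hh', F.map_neg, F.map_comp, hh]
      simp)
    simp [reassoc_of% (comp_distTriang_mor_zero₃₁ _ hT)]
  · intro f
    obtain ⟨k, hk⟩ := h₂.2 (F.map T.mor₂ ≫ f)
    dsimp at hk
    have hk₀ : T.mor₁ ≫ k = 0 := h₁.1 (by
      have h₁₂ := F.congr_map (comp_distTriang_mor_zero₁₂ _ hT)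
      simp only [Functor.map_comp, Functor.map_zero] at h₁₂
      simp [hk, reassoc_of% h₁₂])
    obtain ⟨g, rfl⟩ := T.yoneda_exact₂ hT k hk₀
    obtain ⟨h', hh'⟩ : ∃ h' : (F.obj T.obj₁)⟦(1 : ℤ)⟧ ⟶ F.obj A,
        f - F.map g = (F.map T.mor₃ ≫ (F.commShiftIso (1 : ℤ)).hom.app T.obj₁) ≫ h' :=
      Triangle.yoneda_exact₃ _ hFT (f - F.map g)
        (show F.map T.mor₂ ≫ (f - F.map g) = 0 by
          rw [Functor.map_comp] at hk
          simp [Preadditive.comp_sub, hk])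
    obtain ⟨h, hh⟩ := h₁'.2 ((F.commShiftIso (1 : ℤ)).hom.app T.obj₁ ≫ h')
    refine ⟨g + T.mor₃ ≫ h, ?_⟩
    dsimp at hh ⊢
    rw [F.map_add, F.map_comp, hh, ← Category.assoc, ← hh']
    abel

variable (F)

lemma isStrictlyFullTriangulatedSub_bijectiveOnHom_right (A : C) :
    IsStrictlyFullTriangulatedSub C (fun Y => ∀ n : ℤ, BijectiveOnHom F A (Y⟦n⟧)) := by
  refine ⟨fun X Y e h n => (h n).of_iso (Iso.refl _) ((shiftFunctor C n).mapIso e),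
    fun X m h n => (h (m + n)).of_iso (Iso.refl _) ((shiftFunctorAdd C m n).app X),
    fun T hT h₁ h₂ n => ?_⟩
  exact bijectiveOnHom_obj₃_right (Triangle.shift_distinguished T hT n) (h₁ n) (h₂ n)
    ((h₁ (n + 1)).of_iso (Iso.refl _) ((shiftFunctorAdd C n 1).app _))
    ((h₂ (n + 1)).of_iso (Iso.refl _) ((shiftFunctorAdd C n 1).app _))

lemma isStrictlyFullTriangulatedSub_bijectiveOnHom_left (A : C) :
    IsStrictlyFullTriangulatedSub C (fun X => ∀ n : ℤ, BijectiveOnHom F X (A⟦n⟧)) := by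
  have hshift (X : C) (m : ℤ) (h : ∀ n : ℤ, BijectiveOnHom F X (A⟦n⟧)) (n : ℤ) :
      BijectiveOnHom F (X⟦m⟧) (A⟦n⟧) :=
    ((h (n - m)).shift m).of_iso (Iso.refl _)
      ((shiftFunctorAdd' C (n - m) m n (by lia)).symm.app A)
  exact ⟨fun X Y e h n => (h n).of_iso e (Iso.refl _), hshift,
    fun T hT h₁ h₂ n => bijectiveOnHom_obj₃_left hT (h₁ n) (h₂ n)
      (hshift _ 1 h₁ n) (hshift _ 1 h₂ n)⟩

lemma isStrictlyFullTriangulatedSub_essImage [F.Full] :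
    IsStrictlyFullTriangulatedSub D F.essImage := by
  refine ⟨fun X Y e h => h.ofIso e, fun X n ⟨X', ⟨e⟩⟩ => ⟨X'⟦n⟧,
    ⟨(F.commShiftIso n).app X' ≪≫ (shiftFunctor D n).mapIso e⟩⟩, ?_⟩
  rintro T hT ⟨X, ⟨e₁⟩⟩ ⟨Y, ⟨e₂⟩⟩
  obtain ⟨f, hf⟩ := F.map_surjective (e₁.hom ≫ T.mor₁ ≫ e₂.inv)
  obtain ⟨Z, g, h, hZ⟩ := distinguished_cocone_triangle f
  exact ⟨Z, ⟨Triangle.π₃.mapIso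
    (isoTriangleOfIso₁₂ _ _ (F.map_distinguished _ hZ) hT e₁ e₂
      (show F.map f ≫ e₂.hom = e₁.hom ≫ T.mor₁ by simp [hf]))⟩⟩

end FullyFaithfulOnPairs

/-- A triangulated functor `i : C ⥤ D` between triangulated
categories which is "fully faithful on a set `S` of generators, compatibly with
shifts" (hypothesis `hbij`), and such that `S` generates `C` and `i(S)`
generates `D` as triangulated categories (hypotheses `hgenC`, `hgenD`), is an
equivalence of triangulated categories. -/
theorem statement6 [IsTriangulated C] [IsTriangulated D]
    (i : C ⥤ D) [i.CommShift ℤ] [i.IsTriangulated] (S : Set C)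
    (hgenC : ∀ P : C → Prop, IsStrictlyFullTriangulatedSub C P →
      (∀ M ∈ S, P M) → ∀ X : C, P X)
    (hgenD : ∀ P : D → Prop, IsStrictlyFullTriangulatedSub D P →
      (∀ M ∈ S, P (i.obj M)) → ∀ Y : D, P Y)
    (hbij : ∀ M₁ ∈ S, ∀ M₂ ∈ S, ∀ n : ℤ,
      Function.Bijective (fun f : M₁ ⟶ (M₂⟦n⟧) =>
        i.map f ≫ (i.commShiftIso n).hom.app M₂)) :
    i.IsEquivalence := by
  have hS : ∀ M ∈ S, ∀ Y : C, ∀ n : ℤ, i.BijectiveOnHom M (Y⟦n⟧) := fun M hM =>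
    hgenC _ (isStrictlyFullTriangulatedSub_bijectiveOnHom_right i M)
      fun M' hM' n => (Functor.bijectiveOnHom_shift_iff M M' n).2 (hbij M hM M' hM' n)
  have h (X Y : C) : i.BijectiveOnHom X Y :=
    (hgenC _ (isStrictlyFullTriangulatedSub_bijectiveOnHom_left i Y)
      (fun M hM => hS M hM Y) X 0).of_iso (Iso.refl _) ((shiftFunctorZero C ℤ).app Y)
  have : i.Full := ⟨fun f => (h _ _).2 f⟩
  have : i.Faithful := ⟨fun e => (h _ _).1 e⟩
  have : i.EssSurj := ⟨hgenD _ (isStrictlyFullTriangulatedSub_essImage i)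
    fun M _ => i.obj_mem_essImage M⟩
  exact { }

end Stmt6
end

section
/- Suppose the Yoneda Ext-algebra Ext•_a(k_a, k_a) is isomorphic, as a graded k-algebra, to a polynomial algebra k[x₁,…,xₙ] on finitely many homogeneous generators x₁,…,xₙ, each of even positive degree. Then the dg-algebra REnd_a(k_a) is formal: there exist a projective resolution P of k_a and a graded subalgebra C of the endomorphism dg-algebra End•_a(P) consisting entirely of cocycles, such that the map sending a degree-n cocycle (a chain map P → P[n]) to the class it induces in Extⁿ_a(k_a, k_a) restricts to an isomorphism of graded k-algebras C ≅ Ext•_a(k_a, k_a). -/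
/-!
# Statement 7

Let `k` be a field and `a` (here called `A`) a Hopf algebra over `k` with
counit `ε : A → k`; `k_a` denotes the trivial 1-dimensional left `A`-module on
which `A` acts through `ε` (`TrivMod k A` below).

A projective resolution `P = (⋯ → P⁻¹ → P⁰)` of `k_a` by left `A`-modules is
encoded as a `ℤ`-indexed cochain complex `P` of `A`-modules (`ZComplex A`
below, with differentials in "relation form" `d i j : i + 1 = j → X i →ₗ X j`)
together with an augmentation `ε : P.X 0 →ₗ[A] k_a`, such that all `P.X i` are
projective, `P.X i = 0` for `i > 0`, `ε` is surjective and the augmented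
complex is exact (`IsTrivResolution` below).

The endomorphism dg-algebra `End•_a(P)` has degree-`n` component
`P.End n = ∏_i Hom_A(Pⁱ, P^{i+n})` (in relation form, indexed by `Triplet`s),
multiplication given by composition (`ZComplex.comp`, with unit
`ZComplex.one`), and differential `δ(f) = d_P ∘ f − (−1)ⁿ f ∘ d_P`
(`ZComplex.delta`).  A cocycle is an `f` with `δ f = 0`
(`ZComplex.cocycles`), and `Extⁿ_a(k_a, k_a)` is the space of degree-`n`
cocycles modulo coboundaries (`ZComplex.ExtGrp`, with the class map
`ZComplex.extClass`); the Yoneda product on `Ext•` is induced by composition.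

**Statement**: suppose the Yoneda Ext-algebra `Ext•_a(k_a, k_a)` is
isomorphic, as a graded `k`-algebra, to a polynomial algebra `k[x₁, …, x_N]`
on finitely many homogeneous generators, each of even positive degree (the
graded pieces of the polynomial algebra being the weighted-homogeneous
submodules for the weights `w : Fin N → ℤ`; the isomorphism is a family `e` of
linear isomorphisms in each degree, compatible with units and with products of
classes of cocycles).  Then the dg-algebra `REnd_a(k_a)` is formal: there
exist a projective resolution `P` of `k_a` and a graded subalgebra `C` of
`End•_a(P)` consisting entirely of cocycles (i.e. `C n ≤ cocycles n`, `C`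
contains the identity and is closed under composition) such that the map
sending a degree-`n` cocycle to the class it induces in `Extⁿ_a(k_a, k_a)`
restricts to an isomorphism (degreewise a bijection, automatically compatible
with the products) of graded `k`-algebras `C ≅ Ext•_a(k_a, k_a)`.
-/

open scoped TensorProduct

namespace Stmt7

universe u

/-- The trivial `1`-dimensional left `A`-module `k_a = A ⧸ ker ε`, i.e. `k`
with `A` acting through the counit. -/
def TrivMod (k A : Type u) [Field k] [Ring A] [HopfAlgebra k A] : Type u := k

instance (k A : Type u) [Field k] [Ring A] [HopfAlgebra k A] :
    AddCommGroup (TrivMod k A) := inferInstanceAs (AddCommGroup k)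

noncomputable instance (k A : Type u) [Field k] [Ring A] [HopfAlgebra k A] :
    Module A (TrivMod k A) :=
  Module.compHom k ((Bialgebra.counitAlgHom k A : A →ₐ[k] k) : A →+* k)

/-- A `ℤ`-indexed cochain complex of left `A`-modules, with differentials in
"relation form" (`d i j h : X i →ₗ[A] X j` for every proof `h : i + 1 = j`) to
avoid dependent index arithmetic. -/
structure ZComplex (A : Type u) [Ring A] where
  X : ℤ → Type u
  [addCommGroup : ∀ i, AddCommGroup (X i)]
  [module : ∀ i, Module A (X i)]
  d : ∀ i j : ℤ, i + 1 = j → (X i →ₗ[A] X j)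
  d_comp_d : ∀ (i j l : ℤ) (hij : i + 1 = j) (hjl : j + 1 = l),
      (d j l hjl).comp (d i j hij) = 0

attribute [instance] ZComplex.addCommGroup ZComplex.module

/-- Index for the components of a degree-`n` graded endomorphism. -/
structure Triplet (n : ℤ) where
  p : ℤ
  q : ℤ
  hpq : p + n = q

variable {A : Type u} [Ring A]

/-- The space of degree-`n` endomorphisms of the complex `P`:
`P.End n = ∏_i Hom_A(P.X i, P.X (i+n))`. -/
abbrev ZComplex.End (P : ZComplex A) (n : ℤ) : Type u :=
  ∀ T : Triplet n, P.X T.p →ₗ[A] P.X T.q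

/-- Transport along an equality of indices. -/
def ZComplex.xCast (P : ZComplex A) {i j : ℤ} (h : i = j) : P.X i →ₗ[A] P.X j :=
  cast (show (P.X i →ₗ[A] P.X i) = (P.X i →ₗ[A] P.X j) by rw [h]) LinearMap.id

/-- The multiplication (composition) `End m × End n → End (m + n)` of graded
endomorphisms. -/
def ZComplex.comp (P : ZComplex A) {m n : ℤ} (f : P.End m) (g : P.End n) :
    P.End (m + n) :=
  fun T => (f ⟨T.p + n, T.q, by have h := T.hpq; omega⟩).comp (g ⟨T.p, T.p + n, rfl⟩)

/-- The identity, as a degree-`0` graded endomorphism. -/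
def ZComplex.one (P : ZComplex A) : P.End 0 :=
  fun T => P.xCast (show T.p = T.q by have h := T.hpq; omega)

/-- The differential of the endomorphism dg-algebra:
`δ(f) = d_P ∘ f − (−1)ⁿ · f ∘ d_P` for `f` of degree `n`. -/
def ZComplex.delta (P : ZComplex A) {n : ℤ} (f : P.End n) : P.End (n + 1) :=
  fun T =>
    (P.d (T.p + n) T.q (by have h := T.hpq; omega)).comp (f ⟨T.p, T.p + n, rfl⟩)
      - (Int.negOnePow n : ℤ) •
          ((f ⟨T.p + 1, T.q, by have h := T.hpq; omega⟩).comp (P.d T.p (T.p + 1) rfl))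

variable (k : Type u) [Field k] [HopfAlgebra k A]

/-- Each `P.X i` is a `k`-vector space, `k` acting through `algebraMap k A`. -/
noncomputable instance (P : ZComplex A) (i : ℤ) : Module k (P.X i) :=
  Module.compHom (P.X i) (algebraMap k A)

instance (P : ZComplex A) (i : ℤ) : SMulCommClass A k (P.X i) where
  smul_comm a c x := by
    show a • ((algebraMap k A) c • x) = (algebraMap k A) c • (a • x)
    rw [← mul_smul, ← mul_smul, Algebra.commutes]

instance (P : ZComplex A) (i j : ℤ) : LinearMap.CompatibleSMul (P.X i) (P.X j) k A :=
  ⟨fun f c x => by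
    show f ((algebraMap k A) c • x) = (algebraMap k A) c • f x
    rw [map_smul]⟩

lemma ZComplex.delta_add (P : ZComplex A) {n : ℤ} (f g : P.End n) :
    P.delta (f + g) = P.delta f + P.delta g := by
  funext T
  simp only [ZComplex.delta, Pi.add_apply, LinearMap.comp_add, LinearMap.add_comp, smul_add]
  abel

lemma ZComplex.delta_smul (P : ZComplex A) {n : ℤ} (c : k) (f : P.End n) :
    P.delta (c • f) = c • P.delta f := by
  funext T
  simp only [ZComplex.delta, Pi.smul_apply, smul_sub]
  rw [LinearMap.comp_smul, LinearMap.smul_comp, smul_comm]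

lemma ZComplex.delta_zero (P : ZComplex A) {n : ℤ} : P.delta (0 : P.End n) = 0 := by
  funext T
  simp [ZComplex.delta]

/-- `(P, ε)` is a projective resolution of the trivial module `k_a`: all terms
are projective, the terms in positive degrees vanish, `ε : P.X 0 → k_a` is
surjective, and the augmented complex is exact. -/
structure IsTrivResolution (P : ZComplex A) (ε : P.X 0 →ₗ[A] TrivMod k A) : Prop where
  projective : ∀ i : ℤ, Module.Projective A (P.X i)
  zero_of_pos : ∀ i : ℤ, 0 < i → Subsingleton (P.X i)
  surj : Function.Surjective ε
  exact_at_zero : Function.Exact (P.d (-1) 0 (by omega)) ε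
  exact_at_neg : ∀ i : ℤ, i < 0 →
    Function.Exact (P.d (i - 1) i (by omega)) (P.d i (i + 1) rfl)

/-- The `k`-submodule of degree-`n` cocycles of the endomorphism dg-algebra:
degree-`n` chain maps `P → P[n]`. -/
noncomputable def ZComplex.cocycles (P : ZComplex A) (n : ℤ) :
    Submodule k (P.End n) where
  carrier := {f | P.delta f = 0}
  add_mem' := fun {f g} hf hg => by
    have hf' : P.delta f = 0 := hf
    have hg' : P.delta g = 0 := hg
    show P.delta (f + g) = 0
    rw [ZComplex.delta_add, hf', hg', add_zero]
  zero_mem' := ZComplex.delta_zero P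
  smul_mem' := fun c f hf => by
    have hf' : P.delta f = 0 := hf
    show P.delta (c • f) = 0
    rw [ZComplex.delta_smul, hf', smul_zero]

/-- The `k`-submodule of degree-`n` coboundaries of the endomorphism
dg-algebra. -/
noncomputable def ZComplex.boundaries (P : ZComplex A) (n : ℤ) :
    Submodule k (P.End n) where
  carrier := {f | ∃ g : P.End (n - 1), ∀ T : Triplet n,
      f T = P.delta g ⟨T.p, T.q, by have h := T.hpq; omega⟩}
  add_mem' := fun {f f'} hf hf' => by
    obtain ⟨g, hg⟩ := hf
    obtain ⟨g', hg'⟩ := hf'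
    exact ⟨g + g', fun T => by
      simp only [Pi.add_apply, hg T, hg' T, ZComplex.delta_add]⟩
  zero_mem' :=
    ⟨0, fun T => by simp only [Pi.zero_apply, ZComplex.delta_zero]⟩
  smul_mem' := fun c f hf => by
    obtain ⟨g, hg⟩ := hf
    exact ⟨c • g, fun T => by
      simp only [Pi.smul_apply, hg T, ZComplex.delta_smul]⟩

/-- `Extⁿ_a(k_a, k_a)`, computed from the projective resolution `P` as
degree-`n` cocycles modulo coboundaries of the endomorphism dg-algebra. -/
noncomputable def ZComplex.ExtGrp (P : ZComplex A) (n : ℤ) : Type u :=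
  ↥(ZComplex.cocycles k P n) ⧸
    (ZComplex.boundaries k P n).comap (ZComplex.cocycles k P n).subtype

noncomputable instance (P : ZComplex A) (n : ℤ) :
    AddCommGroup (ZComplex.ExtGrp k P n) :=
  inferInstanceAs (AddCommGroup (↥(ZComplex.cocycles k P n) ⧸
    (ZComplex.boundaries k P n).comap (ZComplex.cocycles k P n).subtype))

noncomputable instance (P : ZComplex A) (n : ℤ) :
    Module k (ZComplex.ExtGrp k P n) :=
  inferInstanceAs (Module k (↥(ZComplex.cocycles k P n) ⧸
    (ZComplex.boundaries k P n).comap (ZComplex.cocycles k P n).subtype))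

/-- The map sending a degree-`n` cocycle to the class it induces in
`Extⁿ_a(k_a, k_a)`. -/
noncomputable def ZComplex.extClass (P : ZComplex A) (n : ℤ) :
    ↥(ZComplex.cocycles k P n) →ₗ[k] ZComplex.ExtGrp k P n :=
  Submodule.mkQ _

section Diagonal

open HopfAlgebra Coalgebra

/-- The tensor product `M ⊗ N` of two `A`-modules, with `A` acting diagonally through the
comultiplication. -/
def Diag (_A k : Type u) [Field k] (M N : Type u) [AddCommGroup M] [Module k M]
    [AddCommGroup N] [Module k N] : Type u :=
  M ⊗[k] N

namespace Diag

section Linear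

variable (A k : Type u) [Field k] (M N : Type u) [AddCommGroup M] [Module k M] [AddCommGroup N]
  [Module k N]

noncomputable instance : AddCommGroup (Diag A k M N) := inferInstanceAs (AddCommGroup (M ⊗[k] N))

noncomputable instance : Module k (Diag A k M N) := inferInstanceAs (Module k (M ⊗[k] N))

variable {M N}

/-- The pure tensor `x ⊗ y`. -/
def tmul (x : M) (y : N) : Diag A k M N := x ⊗ₜ[k] y

variable {A k}

lemma add_tmul (x x' : M) (y : N) : tmul A k (x + x') y = tmul A k x y + tmul A k x' y :=
  TensorProduct.add_tmul x x' y

lemma tmul_add (x : M) (y y' : N) : tmul A k x (y + y') = tmul A k x y + tmul A k x y' :=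
  TensorProduct.tmul_add x y y'

lemma sub_tmul (x x' : M) (y : N) : tmul A k (x - x') y = tmul A k x y - tmul A k x' y :=
  TensorProduct.sub_tmul x x' y

lemma tmul_sub (x : M) (y y' : N) : tmul A k x (y - y') = tmul A k x y - tmul A k x y' :=
  TensorProduct.tmul_sub x y y'

lemma neg_tmul (x : M) (y : N) : tmul A k (-x) y = -tmul A k x y :=
  TensorProduct.neg_tmul x y

@[simp] lemma zero_tmul (y : N) : tmul A k (0 : M) y = 0 := TensorProduct.zero_tmul _ _

@[simp] lemma tmul_zero (x : M) : tmul A k x (0 : N) = 0 := TensorProduct.tmul_zero _ _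

lemma smul_tmul' (c : k) (x : M) (y : N) : tmul A k (c • x) y = c • tmul A k x y :=
  (TensorProduct.smul_tmul' c x y).symm

lemma tmul_smul (c : k) (x : M) (y : N) : tmul A k x (c • y) = c • tmul A k x y :=
  TensorProduct.tmul_smul c x y

lemma addSubgroup_eq_top {p : AddSubgroup (Diag A k M N)} (h : ∀ x y, tmul A k x y ∈ p)
    (t : Diag A k M N) : t ∈ p := by
  induction t using TensorProduct.induction_on with
  | zero => exact p.zero_mem
  | tmul x y => exact h x y
  | add x y hx hy => exact p.add_mem hx hy

/-- Additive maps out of `Diag A k M N` that agree on pure tensors agree. -/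
lemma induction_tmul {G F₁ F₂ : Type*} [AddCommGroup G] [FunLike F₁ (Diag A k M N) G]
    [AddMonoidHomClass F₁ (Diag A k M N) G] [FunLike F₂ (Diag A k M N) G]
    [AddMonoidHomClass F₂ (Diag A k M N) G] (f : F₁) (g : F₂)
    (h : ∀ x y, f (tmul A k x y) = g (tmul A k x y)) (t : Diag A k M N) : f t = g t :=
  addSubgroup_eq_top (p := (f : Diag A k M N →+ G).eqLocus (g : Diag A k M N →+ G)) h t

end Linear

variable {M N : Type u} [AddCommGroup M] [Module k M] [AddCommGroup N] [Module k N]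
  [Module A M] [IsScalarTower k A M] [Module A N] [IsScalarTower k A N]

variable (A M N) in
/-- The diagonal action of `A` on `M ⊗ N`. -/
noncomputable def action : A →ₐ[k] Module.End k (M ⊗[k] N) :=
  (Module.endTensorEndAlgHom (R := k) (S := k) (A := k)).comp
    ((Algebra.TensorProduct.map (Algebra.lsmul k k M) (Algebra.lsmul k k N)).comp
      (Bialgebra.comulAlgHom k A))

noncomputable instance : Module A (Diag A k M N) :=
  Module.compHom (M ⊗[k] N) (action A k M N : A →+* Module.End k (M ⊗[k] N))

lemma smul_def (a : A) (t : Diag A k M N) : a • t = action A k M N a t := rfl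

variable (A) in
/-- The map `A ⊗ A → M ⊗ N`, `a ⊗ b ↦ a • x ⊗ b • y`. -/
noncomputable def orbit (x : M) (y : N) : A ⊗[k] A →ₗ[k] M ⊗[k] N :=
  TensorProduct.map ((LinearMap.toSpanSingleton A M x).restrictScalars k)
    ((LinearMap.toSpanSingleton A N y).restrictScalars k)

lemma smul_tmul (a : A) (x : M) (y : N) :
    a • tmul A k x y = orbit A k x y (comul (R := k) a) := by
  rw [smul_def]
  change Module.endTensorEndAlgHom (R := k) (S := k) (A := k) (Algebra.TensorProduct.map
    (Algebra.lsmul k k M) (Algebra.lsmul k k N) (comul (R := k) a)) (x ⊗ₜ y) = _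
  induction comul (R := k) a using TensorProduct.induction_on with
  | zero => simp
  | tmul b c => simp [orbit, Module.endTensorEndAlgHom]
  | add u v hu hv => rw [map_add, map_add, LinearMap.add_apply, hu, hv, map_add]

instance : IsScalarTower k A (Diag A k M N) where
  smul_assoc c a t :=
    LinearMap.congr_fun (map_smul (action A k M N) c a) t

variable {k}

variable {M' N' : Type u} [AddCommGroup M'] [Module k M'] [AddCommGroup N'] [Module k N']
  [Module A M'] [IsScalarTower k A M'] [Module A N'] [IsScalarTower k A N']

/-- The `A`-linear map `f ⊗ g` for the diagonal actions. -/
noncomputable def map (f : M →ₗ[A] M') (g : N →ₗ[A] N') : Diag A k M N →ₗ[A] Diag A k M' N' where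
  toFun := TensorProduct.map (f.restrictScalars k) (g.restrictScalars k)
  map_add' := map_add _
  map_smul' a t := by
    let F := TensorProduct.map (f.restrictScalars k) (g.restrictScalars k)
    let p : AddSubgroup (Diag A k M N) :=
      (F.toAddMonoidHom.comp (action A k M N a).toAddMonoidHom).eqLocus
        ((action A k M' N' a).toAddMonoidHom.comp F.toAddMonoidHom)
    refine addSubgroup_eq_top (p := p) (fun x y => ?_) t
    have h : F ∘ₗ orbit A k x y = orbit A k (f x) (g y) := by
      ext b c
      simp [F, orbit]
    have h' : F (a • tmul A k x y) = (F ∘ₗ orbit A k x y) (comul (R := k) a) := by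
      rw [smul_tmul]; rfl
    exact h'.trans (by rw [h]; exact (smul_tmul k a (f x) (g y)).symm)

@[simp] lemma map_tmul (f : M →ₗ[A] M') (g : N →ₗ[A] N') (x : M) (y : N) :
    map f g (tmul A k x y) = tmul A k (f x) (g y) := rfl

/-- `x ⊗ y ↦ ε y • x` is `A`-linear when `ε` is compatible with the counit. -/
noncomputable def counitRight (ε : N →ₗ[k] k)
    (hε : ∀ (a : A) y, ε (a • y) = counit (R := k) a * ε y) :
    Diag A k M N →ₗ[A] M where
  toFun := TensorProduct.rid k M ∘ₗ TensorProduct.map LinearMap.id ε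
  map_add' := map_add _
  map_smul' a t := by
    let F : M ⊗[k] N →ₗ[k] M := TensorProduct.rid k M ∘ₗ TensorProduct.map LinearMap.id ε
    let p : AddSubgroup (Diag A k M N) :=
      (F.toAddMonoidHom.comp (action A k M N a).toAddMonoidHom).eqLocus
        ((Algebra.lsmul k k M a).toAddMonoidHom.comp F.toAddMonoidHom)
    refine addSubgroup_eq_top (p := p) (fun x y => ?_) t
    have h : F ∘ₗ orbit A k x y = ε y • (LinearMap.toSpanSingleton A M x).restrictScalars k ∘ₗ
        TensorProduct.rid k A ∘ₗ (counit (R := k) (A := A)).lTensor A := by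
      ext b c
      simp [F, orbit, hε, mul_comm (counit (R := k) _), mul_smul]
    calc F (a • tmul A k x y) = (F ∘ₗ orbit A k x y) (comul (R := k) a) := by rw [smul_tmul]; rfl
      _ = a • F (tmul A k x y) := by
        rw [h]
        simp [F, tmul, smul_algebra_smul_comm]

/-- `x ⊗ y ↦ ε x • y` is `A`-linear when `ε` is compatible with the counit. -/
noncomputable def counitLeft (ε : M →ₗ[k] k)
    (hε : ∀ (a : A) x, ε (a • x) = counit (R := k) a * ε x) :
    Diag A k M N →ₗ[A] N where
  toFun := TensorProduct.lid k N ∘ₗ TensorProduct.map ε LinearMap.id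
  map_add' := map_add _
  map_smul' a t := by
    let F : M ⊗[k] N →ₗ[k] N := TensorProduct.lid k N ∘ₗ TensorProduct.map ε LinearMap.id
    let p : AddSubgroup (Diag A k M N) :=
      (F.toAddMonoidHom.comp (action A k M N a).toAddMonoidHom).eqLocus
        ((Algebra.lsmul k k N a).toAddMonoidHom.comp F.toAddMonoidHom)
    refine addSubgroup_eq_top (p := p) (fun x y => ?_) t
    have h : F ∘ₗ orbit A k x y = ε x • (LinearMap.toSpanSingleton A N y).restrictScalars k ∘ₗ
        TensorProduct.lid k A ∘ₗ (counit (R := k) (A := A)).rTensor A := by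
      ext b c
      simp [F, orbit, hε, mul_comm (counit (R := k) _), mul_smul]
    calc F (a • tmul A k x y) = (F ∘ₗ orbit A k x y) (comul (R := k) a) := by rw [smul_tmul]; rfl
      _ = a • F (tmul A k x y) := by
        rw [h]
        simp [F, tmul, smul_algebra_smul_comm]

@[simp] lemma counitRight_tmul (ε : N →ₗ[k] k) (hε) (x : M) (y : N) :
    counitRight (A := A) ε hε (tmul A k x y) = ε y • x := by
  exact TensorProduct.rid_tmul x (ε y)

@[simp] lemma counitLeft_tmul (ε : M →ₗ[k] k) (hε) (x : M) (y : N) :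
    counitLeft (A := A) ε hε (tmul A k x y) = ε x • y := by
  exact TensorProduct.lid_tmul y (ε x)

end Diag

end Diagonal

section Projective

open HopfAlgebra Coalgebra

variable {k} {W : Type u} [AddCommGroup W] [Module k W]

/-- The map `A ⊗ W → A ⊗ W`, `a ⊗ w ↦ ∑ a₁ ⊗ F a₂ w`. -/
noncomputable def comulTwist (F : A →ₗ[k] Module.End k W) : A ⊗[k] W →ₗ[k] A ⊗[k] W :=
  (TensorProduct.lift F).lTensor A ∘ₗ (TensorProduct.assoc k A A W).toLinearMap ∘ₗ
    (comul (R := k) (A := A)).rTensor W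

lemma comulTwist_tmul (F : A →ₗ[k] Module.End k W) (a : A) (w : W) :
    comulTwist F (a ⊗ₜ w) = (F.flip w).lTensor A (comul (R := k) a) := by
  simp only [comulTwist, LinearMap.comp_apply, LinearMap.rTensor_tmul, LinearEquiv.coe_coe]
  induction comul (R := k) a using TensorProduct.induction_on with
  | zero => simp
  | tmul b c => simp
  | add u v hu hv => rw [TensorProduct.add_tmul, map_add, map_add, map_add, hu, hv]

lemma comulTwist_comp (F G : A →ₗ[k] Module.End k W) :
    comulTwist F ∘ₗ comulTwist G =
      comulTwist (LinearMap.mul' k _ ∘ₗ TensorProduct.map F G ∘ₗ comul (R := k)) := by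
  ext a w
  let g : A ⊗[k] A →ₗ[k] W := LinearMap.applyₗ w ∘ₗ LinearMap.mul' k _ ∘ₗ TensorProduct.map F G
  have h : comulTwist F ∘ₗ (G.flip w).lTensor A =
      g.lTensor A ∘ₗ (TensorProduct.assoc k A A A).toLinearMap ∘ₗ
        (comul (R := k) (A := A)).rTensor A := by
    ext b c
    simp only [TensorProduct.AlgebraTensorModule.curry_apply, TensorProduct.curry_apply,
      LinearMap.coe_restrictScalars, LinearMap.comp_apply, LinearMap.lTensor_tmul,
      LinearMap.rTensor_tmul, comulTwist_tmul, LinearEquiv.coe_coe]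
    induction comul (R := k) b using TensorProduct.induction_on with
    | zero => simp
    | tmul b c => simp [g]
    | add u v hu hv => rw [TensorProduct.add_tmul, map_add, map_add, map_add, hu, hv]
  have hc := LinearMap.congr_fun (coassoc (R := k) (A := A)) a
  have hg : (LinearMap.mul' k _ ∘ₗ TensorProduct.map F G ∘ₗ comul (R := k)).flip w =
      g ∘ₗ comul (R := k) := rfl
  calc comulTwist F (comulTwist G (a ⊗ₜ w))
      = (comulTwist F ∘ₗ (G.flip w).lTensor A) (comul (R := k) a) := by
        rw [comulTwist_tmul]; rfl
    _ = g.lTensor A ((comul (R := k)).lTensor A (comul (R := k) a)) := by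
        rw [h]; exact congrArg (g.lTensor A) hc
    _ = comulTwist (LinearMap.mul' k _ ∘ₗ TensorProduct.map F G ∘ₗ comul (R := k)) (a ⊗ₜ w) := by
        rw [comulTwist_tmul, hg]
        exact (LinearMap.congr_fun (LinearMap.lTensor_comp A g (comul (R := k))) _).symm

lemma comulTwist_counit :
    comulTwist ((Algebra.linearMap k (Module.End k W)) ∘ₗ counit (R := k) (A := A)) =
      LinearMap.id := by
  ext a w
  have h : ((Algebra.linearMap k (Module.End k W) ∘ₗ counit (R := k) (A := A)).flip w) =
      LinearMap.toSpanSingleton k W w ∘ₗ counit (R := k) (A := A) := by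
    ext; simp
  simp [comulTwist_tmul, h, LinearMap.lTensor_comp]

lemma comulTwist_bijective (F : A →ₐ[k] Module.End k W) :
    Function.Bijective (comulTwist (F : A →ₗ[k] Module.End k W)) := by
  have hm : LinearMap.mul' k (Module.End k W) ∘ₗ TensorProduct.map (F : A →ₗ[k] _) (F : A →ₗ[k] _) =
      (F : A →ₗ[k] _) ∘ₗ LinearMap.mul' k A := by
    ext; simp
  have h₁ : LinearMap.mul' k (Module.End k W) ∘ₗ TensorProduct.map (F : A →ₗ[k] _)
      ((F : A →ₗ[k] _) ∘ₗ antipode k) ∘ₗ comul (R := k) =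
      Algebra.linearMap k (Module.End k W) ∘ₗ counit := by
    ext1 a
    have := congrArg (F : A →ₗ[k] Module.End k W) (mul_antipode_lTensor_comul_apply (R := k) a)
    have h' := LinearMap.congr_fun hm ((antipode k).lTensor A (comul (R := k) a))
    have hh : TensorProduct.map (F : A →ₗ[k] Module.End k W)
        ((F : A →ₗ[k] Module.End k W) ∘ₗ antipode k) = TensorProduct.map (F : A →ₗ[k] _)
          (F : A →ₗ[k] _) ∘ₗ (antipode k).lTensor A := by
      ext; simp
    rw [hh]
    exact h'.trans (this.trans (F.commutes _))
  have h₂ : LinearMap.mul' k (Module.End k W) ∘ₗ TensorProduct.map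
      ((F : A →ₗ[k] _) ∘ₗ antipode k) (F : A →ₗ[k] _) ∘ₗ comul (R := k) =
      Algebra.linearMap k (Module.End k W) ∘ₗ counit := by
    ext1 a
    have := congrArg (F : A →ₗ[k] Module.End k W) (mul_antipode_rTensor_comul_apply (R := k) a)
    have h' := LinearMap.congr_fun hm ((antipode k).rTensor A (comul (R := k) a))
    have hh : TensorProduct.map ((F : A →ₗ[k] Module.End k W) ∘ₗ antipode k)
        (F : A →ₗ[k] Module.End k W) = TensorProduct.map (F : A →ₗ[k] _)
          (F : A →ₗ[k] _) ∘ₗ (antipode k).rTensor A := by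
      ext; simp
    rw [hh]
    exact h'.trans (this.trans (F.commutes _))
  refine Function.bijective_iff_has_inverse.mpr
    ⟨comulTwist ((F : A →ₗ[k] Module.End k W) ∘ₗ antipode k), fun x => ?_, fun x => ?_⟩
  · rw [← LinearMap.comp_apply, comulTwist_comp, h₂, comulTwist_counit, LinearMap.id_apply]
  · rw [← LinearMap.comp_apply, comulTwist_comp, h₁, comulTwist_counit, LinearMap.id_apply]

variable (M N : Type u) [AddCommGroup M] [Module k M] [AddCommGroup N] [Module k N]
  [Module A N] [IsScalarTower k A N]

/-- For `A` acting on `A ⊗ M` through the first factor, `(A ⊗ M) ⊗ N` with the diagonal action is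
isomorphic to `A ⊗ (M ⊗ N)` with `A` acting on the first factor only. -/
lemma Diag.projective_free : Module.Projective A (Diag A k (A ⊗[k] M) N) := by
  let W := M ⊗[k] N
  let F : A →ₐ[k] Module.End k W :=
    (Module.endTensorEndAlgHom (R := k) (S := k) (A := k) (M := M) (N := N)).comp
      (Algebra.TensorProduct.includeRight.comp (Algebra.lsmul k k N))
  let e : A ⊗[k] W →ₗ[k] Diag A k (A ⊗[k] M) N :=
    (TensorProduct.assoc k A M N).symm.toLinearMap ∘ₗ comulTwist (F : A →ₗ[k] Module.End k W)
  have he : ∀ a w, e (a ⊗ₜ w) = a • e (1 ⊗ₜ w) := by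
    have key : ∀ (a : A) (m : M) (n : N), e (a ⊗ₜ (m ⊗ₜ n)) =
        a • tmul A k ((1 : A) ⊗ₜ[k] m) n := by
      intro a m n
      rw [Diag.smul_tmul]
      change (TensorProduct.assoc k A M N).symm
        (comulTwist (F : A →ₗ[k] Module.End k W) (a ⊗ₜ (m ⊗ₜ n))) = _
      rw [comulTwist_tmul]
      induction comul (R := k) a using TensorProduct.induction_on with
      | zero => simp
      | tmul b c => simp [F, orbit, Module.endTensorEndAlgHom, TensorProduct.smul_tmul']; rfl
      | add u v hu hv => rw [map_add, map_add, map_add, hu, hv]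
    intro a w
    induction w using TensorProduct.induction_on with
    | zero => simp
    | tmul m n => rw [key, key, one_smul]
    | add x y hx hy => rw [TensorProduct.tmul_add, TensorProduct.tmul_add, map_add, map_add, hx, hy,
        smul_add]
  have hA : ∀ (a : A) t, e (a • t) = a • e t := by
    intro a t
    induction t using TensorProduct.induction_on with
    | zero => simp
    | tmul b w => rw [TensorProduct.smul_tmul', he, he b, smul_eq_mul, mul_smul]
    | add x y hx hy => rw [smul_add, map_add, map_add, hx, hy, smul_add]
  let eA : A ⊗[k] W →ₗ[A] Diag A k (A ⊗[k] M) N :=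
    { toFun := e, map_add' := map_add e, map_smul' := hA }
  exact Module.Projective.of_equiv' (LinearEquiv.ofBijective eA
    ((TensorProduct.assoc k A M N).symm.bijective.comp (comulTwist_bijective F)))

variable {M N} in
/-- The diagonal tensor product of a projective module with any module is projective. -/
lemma Diag.projective [Module A M] [IsScalarTower k A M] [Module.Projective A M] :
    Module.Projective A (Diag A k M N) := by
  let r₀ : A ⊗[k] M →ₗ[k] M := TensorProduct.lift (Algebra.lsmul k k M).toLinearMap
  let r : A ⊗[k] M →ₗ[A] M :=
    { toFun := r₀
      map_add' := map_add r₀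
      map_smul' := fun a t => by
        induction t using TensorProduct.induction_on with
        | zero => simp
        | tmul b w => simp [r₀, TensorProduct.smul_tmul']
        | add x y hx hy => rw [smul_add, map_add, map_add, hx, hy, smul_add] }
  have hr : ∀ x, r (1 ⊗ₜ x) = x := fun x => by simp [r, r₀]
  obtain ⟨i, hi⟩ := Module.projective_lifting_property r LinearMap.id fun x => ⟨_, hr x⟩
  have := Diag.projective_free (A := A) (k := k) M N
  refine Module.Projective.of_split (map (k := k) i (LinearMap.id (M := N)))
    (map r LinearMap.id) ?_
  ext t
  refine induction_tmul (map r LinearMap.id ∘ₗ map (k := k) i (LinearMap.id (M := N)))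
    (LinearMap.id (R := A)) (fun x y => ?_) t
  simpa using congrArg (fun x => tmul A k x y) (LinearMap.congr_fun hi x)

end Projective

section Resolutions

open HopfAlgebra Coalgebra

/-- A family of linear maps on the pieces of a grading assembles to a linear map. -/
lemma exists_linearMap_of_grading {R M N : Type*} [Ring R] [AddCommGroup M] [Module R M]
    [AddCommGroup N] [Module R N] {π : ℤ → M →ₗ[R] M} (π_self : ∀ i x, π i (π i x) = π i x)
    (π_of_ne : ∀ i j, i ≠ j → ∀ x, π i (π j x) = 0)
    (mem_of_π_mem : ∀ p : AddSubgroup M, (∀ i x, π i x ∈ p) → ∀ x, x ∈ p)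
    (H : ℤ → M →ₗ[R] N) : ∃ F : M →ₗ[R] N, ∀ i x, F (π i x) = H i (π i x) := by
  let p : AddSubgroup M :=
    { carrier := {x | {i | π i x ≠ 0}.Finite}
      zero_mem' := by simp
      add_mem' := fun {x y} hx hy => (hx.union hy).subset fun i hi => by
        by_contra h
        simp only [Set.mem_union, Set.mem_ofPred_eq, not_or, not_not] at h
        exact hi (by rw [map_add, h.1, h.2, add_zero])
      neg_mem' := fun {x} hx => by simpa using hx }
  have hp : ∀ x, {i | π i x ≠ 0}.Finite := mem_of_π_mem p fun i x =>
    (Set.finite_singleton i).subset fun j hj => by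
      by_contra h
      exact hj (π_of_ne j i h x)
  have hfin : ∀ x, (Function.support fun i => H i (π i x)).Finite := fun x =>
    (hp x).subset fun i hi h => hi (by simp [h])
  let F : M →ₗ[R] N :=
    { toFun := fun x => ∑ᶠ i, H i (π i x)
      map_add' := fun x y => by
        rw [← finsum_add_distrib (hfin x) (hfin y)]
        simp
      map_smul' := fun a x => by
        simp only [map_smul, RingHom.id_apply]
        exact (smul_finsum' a (hfin x)).symm }
  refine ⟨F, fun i x => ?_⟩
  change ∑ᶠ j, H j (π j (π i x)) = _
  rw [finsum_eq_single _ i fun j hj => by rw [π_of_ne j i hj, map_zero], π_self]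

/-- An exact augmented complex of vector spaces has a contracting homotopy. -/
lemma exists_contraction {K M : Type*} [Field K] [AddCommGroup M] [Module K M]
    {π : ℤ → M →ₗ[K] M} (π_self : ∀ i x, π i (π i x) = π i x)
    (π_of_ne : ∀ i j, i ≠ j → ∀ x, π i (π j x) = 0) (π_of_pos : ∀ i, 0 < i → ∀ x, π i x = 0)
    (mem_of_π_mem : ∀ p : AddSubgroup M, (∀ i x, π i x ∈ p) → ∀ x, x ∈ p)
    {d : M →ₗ[K] M} (d_d : ∀ x, d (d x) = 0) (d_π : ∀ i x, d (π i x) = π (i + 1) (d x))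
    {ε : M →ₗ[K] K} (ε_d : ∀ x, ε (d x) = 0) (ε_π_zero : ∀ x, ε (π 0 x) = ε x)
    {η : M} (ε_η : ε η = 1) (π_zero_η : π 0 η = η)
    (exact : ∀ x, d x = 0 → ε x = 0 → ∃ y, d y = x) :
    ∃ s : M →ₗ[K] M, (∀ i x, s (π i x) = π (i - 1) (s x)) ∧
      ∀ x, d (s x) + s (d x) = x - ε x • η := by
  obtain ⟨g, hg⟩ := d.rangeRestrict.exists_rightInverse_of_surjective d.range_rangeRestrict
  obtain ⟨T, hT⟩ := g.exists_extend
  have hT' : ∀ x, d (T (d x)) = d x := fun x => by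
    have h := LinearMap.congr_fun hT ⟨d x, x, rfl⟩
    rw [LinearMap.comp_apply, Submodule.subtype_apply] at h
    rw [h]
    exact congrArg Subtype.val (LinearMap.congr_fun hg ⟨d x, x, rfl⟩)
  obtain ⟨S, hS⟩ := exists_linearMap_of_grading π_self π_of_ne mem_of_π_mem
    fun i => π (i - 1) ∘ₗ T
  have hext : ∀ f g : M →ₗ[K] M, (∀ i x, f (π i x) = g (π i x)) → ∀ x, f x = g x :=
    fun f g h x => mem_of_π_mem ((f : M →+ M).eqLocus (g : M →+ M)) h x
  have S_π : ∀ i x, S (π i x) = π (i - 1) (S x) := fun i x =>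
    hext (S ∘ₗ π i) (π (i - 1) ∘ₗ S) (fun j y => by
      simp only [LinearMap.comp_apply, hS]
      by_cases h : i = j
      · subst h; rw [π_self, π_self]
      · rw [π_of_ne i j h, map_zero, map_zero, π_of_ne _ _ (by omega)]) x
  have dSd : ∀ x, d (S (d x)) = d x := hext (d ∘ₗ S ∘ₗ d) d fun i x => by
    simp only [LinearMap.comp_apply]
    rw [d_π, hS, ← d_π, LinearMap.comp_apply, add_sub_cancel_right, d_π i (T _), hT', ← d_π, π_self]
  have ε_S : ∀ x, ε (S x) = 0 := fun x => by
    have h := S_π 1 x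
    rw [π_of_pos 1 one_pos, map_zero] at h
    rw [← ε_π_zero, show (0 : ℤ) = 1 - 1 by norm_num, ← h, map_zero]
  have d_η : d η = 0 := by rw [← π_zero_η, d_π, π_of_pos _ (by norm_num)]
  let B : M →ₗ[K] M := LinearMap.id - LinearMap.toSpanSingleton K M η ∘ₗ ε - S ∘ₗ d
  have hB : ∀ x, B x = x - ε x • η - S (d x) := fun x => rfl
  have B_π : ∀ i x, B (π i x) = π i (B x) := fun i x => by
    have h : ε (π i x) • η = ε x • π i η := by
      by_cases hi : i = 0
      · rw [hi, ε_π_zero, π_zero_η]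
      · rw [← ε_π_zero, π_of_ne 0 i (Ne.symm hi), ← π_zero_η, π_of_ne i 0 hi]; simp
    rw [hB, hB, h, d_π, S_π, add_sub_cancel_right]
    simp
  refine ⟨S ∘ₗ B, fun i x => by simp [B_π, S_π], fun x => ?_⟩
  obtain ⟨y, hy⟩ := exact (B x) (by simp [hB, d_η, dSd]) (by simp [hB, ε_η, ε_S])
  have h : B (d x) = d x := by simp [hB, d_d, ε_d]
  rw [LinearMap.comp_apply, LinearMap.comp_apply, h, ← hy, dSd, hy, hB]
  abel

/-- A projective resolution of the trivial module, recorded as the direct sum `M` of its terms: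
`π i` is the projection onto the degree `i` part, `d` the differential, `ε` the augmentation,
and `s` a `k`-linear contracting homotopy of the augmented complex. -/
structure Res (A k : Type u) [Ring A] [Field k] [HopfAlgebra k A] where
  M : Type u
  [addCommGroup : AddCommGroup M]
  [moduleBase : Module k M]
  [module : Module A M]
  [isScalarTower : IsScalarTower k A M]
  [projective : Module.Projective A M]
  π : ℤ → M →ₗ[A] M
  π_self : ∀ i x, π i (π i x) = π i x
  π_of_ne : ∀ i j, i ≠ j → ∀ x, π i (π j x) = 0
  π_of_pos : ∀ i, 0 < i → ∀ x, π i x = 0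
  mem_of_π_mem : ∀ p : AddSubgroup M, (∀ i x, π i x ∈ p) → ∀ x, x ∈ p
  d : M →ₗ[A] M
  d_d : ∀ x, d (d x) = 0
  d_π : ∀ i x, d (π i x) = π (i + 1) (d x)
  ε : M →ₗ[k] k
  ε_smul : ∀ (a : A) x, ε (a • x) = counit (R := k) a * ε x
  ε_d : ∀ x, ε (d x) = 0
  ε_π_zero : ∀ x, ε (π 0 x) = ε x
  η : M
  ε_η : ε η = 1
  π_zero_η : π 0 η = η
  s : M →ₗ[k] M
  s_π : ∀ i x, s (π i x) = π (i - 1) (s x)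
  d_s : ∀ x, d (s x) + s (d x) = x - ε x • η

attribute [instance] Res.addCommGroup Res.moduleBase Res.module Res.isScalarTower Res.projective

namespace Res

variable {k} (D D' D'' : Res A k)

/-- `F` is homogeneous of degree `n`. -/
def Homog {D D' : Res A k} (n : ℤ) (F : D.M →ₗ[A] D'.M) : Prop :=
  ∀ i x, F (D.π i x) = D'.π (i + n) (F x)

variable {D D' D''}

/-- Additive maps that agree on homogeneous elements agree. -/
lemma ext_π {G F₁ F₂ : Type*} [AddCommGroup G] [FunLike F₁ D.M G]
    [AddMonoidHomClass F₁ D.M G] [FunLike F₂ D.M G] [AddMonoidHomClass F₂ D.M G] (f : F₁) (g : F₂)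
    (h : ∀ i x, f (D.π i x) = g (D.π i x)) (x : D.M) : f x = g x :=
  D.mem_of_π_mem ((f : D.M →+ G).eqLocus (g : D.M →+ G)) h x

/-- The linear map that is given by `H i` in degree `i`. -/
noncomputable def asm {N : Type*} [AddCommGroup N] [Module A N] (H : ℤ → D.M →ₗ[A] N) :
    D.M →ₗ[A] N :=
  (exists_linearMap_of_grading D.π_self D.π_of_ne D.mem_of_π_mem H).choose

lemma asm_π {N : Type*} [AddCommGroup N] [Module A N] (H : ℤ → D.M →ₗ[A] N) (i : ℤ) (x : D.M) :
    asm H (D.π i x) = H i (D.π i x) :=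
  (exists_linearMap_of_grading D.π_self D.π_of_ne D.mem_of_π_mem H).choose_spec i x

lemma d_η : D.d D.η = 0 := by
  rw [← D.π_zero_η, D.d_π, D.π_of_pos _ (by norm_num)]

lemma ε_π_of_ne {i : ℤ} (hi : i ≠ 0) (x : D.M) : D.ε (D.π i x) = 0 := by
  rw [← D.ε_π_zero, D.π_of_ne 0 i hi.symm, map_zero]

lemma ε_s (x : D.M) : D.ε (D.s x) = 0 := by
  have h := D.s_π 1 x
  rw [D.π_of_pos 1 one_pos, map_zero] at h
  rw [← D.ε_π_zero, show (0 : ℤ) = 1 - 1 by norm_num, ← h, map_zero]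

lemma d_s_of_d_eq_zero {x : D.M} (h : D.d x = 0) (h' : D.ε x = 0) : D.d (D.s x) = x := by
  simpa [h, h'] using D.d_s x

lemma π_d (i : ℤ) (x : D.M) : D.π i (D.d x) = D.d (D.π (i - 1) x) := by
  rw [D.d_π, sub_add_cancel]

lemma π_s (i : ℤ) (x : D.M) : D.π i (D.s x) = D.s (D.π (i + 1) x) := by
  rw [D.s_π, add_sub_cancel_right]

namespace Homog

variable {m n : ℤ} {F F' : D.M →ₗ[A] D'.M}

lemma π_apply (hF : Homog n F) (i : ℤ) (x : D.M) : D'.π i (F x) = F (D.π (i - n) x) := by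
  rw [hF, sub_add_cancel]

lemma add (hF : Homog n F) (hF' : Homog n F') : Homog n (F + F') := fun i x => by
  simp [hF i x, hF' i x]

lemma neg (hF : Homog n F) : Homog n (-F) := fun i x => by simp [hF i x]

lemma sub (hF : Homog n F) (hF' : Homog n F') : Homog n (F - F') := fun i x => by
  simp [hF i x, hF' i x]

lemma zero : Homog n (0 : D.M →ₗ[A] D'.M) := fun i x => by simp

lemma id : Homog 0 (LinearMap.id : D.M →ₗ[A] D.M) := fun i x => by simp

lemma comp {G : D'.M →ₗ[A] D''.M} (hG : Homog m G) (hF : Homog n F) : Homog (n + m) (G ∘ₗ F) :=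
  fun i x => by simp [hF i x, hG (i + n) (F x), add_assoc]

lemma d : Homog 1 D.d := D.d_π

end Homog

/-- Two linear maps into `D'` and `D''` that lift along the differential do so compatibly with
degrees. -/
lemma exists_lift (F : D.M →ₗ[A] D'.M) (hd : ∀ x, D'.d (F x) = 0) (hε : ∀ x, D'.ε (F x) = 0)
    (j : ℤ) (hj : ∀ x, D'.π j (F x) = F x) :
    ∃ H : D.M →ₗ[A] D'.M, (∀ x, D'.d (H x) = F x) ∧ (∀ x, D'.ε (H x) = 0) ∧
      ∀ x, D'.π (j - 1) (H x) = H x := by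
  let K : Submodule A D'.M :=
    { carrier := {x | D'.ε x = 0}
      zero_mem' := map_zero _
      add_mem' := fun {x y} (hx : _ = _) (hy : _ = _) => by simp [hx, hy]
      smul_mem' := fun a x (hx : _ = _) => by simp [D'.ε_smul, hx] }
  let Z : Submodule A D'.M := LinearMap.ker D'.d ⊓ K
  let dK : K →ₗ[A] Z := (D'.d ∘ₗ K.subtype).codRestrict Z fun x => ⟨D'.d_d x, D'.ε_d x⟩
  have hsurj : Function.Surjective dK := fun z =>
    ⟨⟨D'.s z, ε_s _⟩, Subtype.ext (d_s_of_d_eq_zero z.2.1 z.2.2)⟩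
  obtain ⟨H, hH⟩ := Module.projective_lifting_property dK
    (F.codRestrict Z fun x => ⟨hd x, hε x⟩) hsurj
  have hH' : ∀ x, D'.d (H x) = F x := fun x => congrArg Subtype.val (LinearMap.congr_fun hH x)
  refine ⟨D'.π (j - 1) ∘ₗ K.subtype ∘ₗ H, fun x => ?_, fun x => ?_, fun x => D'.π_self _ _⟩
  · simp [D'.d_π, hH', hj]
  · by_cases h : j - 1 = 0
    · rw [h]; exact (D'.ε_π_zero _).trans (H x).2
    · exact ε_π_of_ne h _

/-- The fundamental lemma on chain maps between resolutions. -/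
lemma exists_homotopy {n c : ℤ} {G : D.M →ₗ[A] D'.M} (hG : Homog n G)
    (hd : ∀ x, D'.d (G x) = c • G (D.d x)) (hε : ∀ x, D'.ε (G x) = 0) :
    ∃ h : D.M →ₗ[A] D'.M, Homog (n - 1) h ∧ (∀ x, D'.ε (h x) = 0) ∧
      ∀ x, G x = D'.d (h x) + c • h (D.d x) := by
  let Spec : ℕ → (D.M →ₗ[A] D'.M) → Prop := fun m H =>
    (∀ x, D'.ε (H x) = 0) ∧ (∀ x, D'.π (n - m) (H x) = H x) ∧
      ∀ x, D'.d (H (D.d x)) = G (D.π (1 - m) (D.d x))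
  have step : ∀ (m : ℕ) (H : {H // Spec m H}), ∃ H' : {H' // Spec (m + 1) H'},
      ∀ x, D'.d (H'.1 x) = G (D.π (-m) x) - c • H.1 (D.d (D.π (-m) x)) := by
    rintro m ⟨H, h₁, h₂, h₃⟩
    obtain ⟨H', h, h', h''⟩ := exists_lift (D := D) (D' := D')
      (G ∘ₗ D.π (-m) - c • H ∘ₗ D.d ∘ₗ D.π (-m)) (fun x => by
        have : D'.d (H (D.d (D.π (-m) x))) = G (D.d (D.π (-m) x)) := by
          rw [h₃, D.d_π, show 1 - (m : ℤ) = -m + 1 by ring, D.π_self]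
        simp [hd, this]) (fun x => by simp [hε, h₁]) (n - m)
        (fun x => by
          simp only [LinearMap.sub_apply, LinearMap.smul_apply, LinearMap.comp_apply, map_sub,
            h₂, map_zsmul]
          rw [hG.π_apply, show n - m - n = -(m : ℤ) by ring, D.π_self])
    refine ⟨⟨H', h', fun x => ?_, fun x => ?_⟩, h⟩
    · rw [show n - ((m + 1 : ℕ) : ℤ) = n - m - 1 by push_cast; ring, h'']
    · rw [h, show 1 - ((m + 1 : ℕ) : ℤ) = -m by push_cast; ring]
      simp [D.d_d, π_d]
  choose next hnext using step
  let Hs : ∀ m, {H // Spec m H} := fun m => Nat.rec ⟨0, by simp, by simp, fun x => by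
    simp [D.π_of_pos 1 one_pos]⟩ next m
  have hs : ∀ m, Hs (m + 1) = next m (Hs m) := fun m => rfl
  have h0 : (Hs 0).1 = 0 := rfl
  let h := asm fun i => (Hs (1 - i).toNat).1
  have hneg : ∀ (m : ℕ) x, h (D.π (-m) x) = (Hs (m + 1)).1 (D.π (-m) x) := fun m x => by
    rw [asm_π, show (1 - (-(m : ℤ))).toNat = m + 1 by omega]
  have hcases : ∀ i : ℤ, 0 < i ∨ ∃ m : ℕ, i = -m := fun i => by
    by_cases hi : 0 < i
    · exact Or.inl hi
    · exact Or.inr ⟨(-i).toNat, by omega⟩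
  refine ⟨h, ?_, fun x => ?_, fun x => ?_⟩
  · intro i x
    have key : ∀ i x, D'.π (i + (n - 1)) (h (D.π i x)) = h (D.π i x) := fun i x => by
      rcases hcases i with hi | ⟨m, rfl⟩
      · simp [D.π_of_pos i hi]
      · rw [hneg, show -(m : ℤ) + (n - 1) = n - (m + 1 : ℕ) by push_cast; ring]
        exact (Hs (m + 1)).2.2.1 _
    refine ext_π (h ∘ₗ D.π i) (D'.π (i + (n - 1)) ∘ₗ h) (fun j y => ?_) x
    simp only [LinearMap.comp_apply]
    by_cases hij : i = j
    · subst hij; rw [D.π_self, key]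
    · rw [D.π_of_ne i j hij, map_zero, ← key, D'.π_of_ne]
      omega
  · refine ext_π (D'.ε.toAddMonoidHom.comp h.toAddMonoidHom) (0 : D.M →+ k) (fun i y => ?_) x
    exact (congrArg D'.ε (asm_π _ i y)).trans ((Hs _).2.1 _)
  · refine ext_π G (D'.d ∘ₗ h + c • h ∘ₗ D.d) (fun i y => ?_) x
    rcases hcases i with hi | ⟨m, rfl⟩
    · simp [D.π_of_pos i hi]
    · have h1 : h (D.d (D.π (-m) y)) = (Hs m).1 (D.d (D.π (-m) y)) := by
        rw [D.d_π, asm_π, show (1 - (-(m : ℤ) + 1)).toNat = m by omega]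
      simp [hneg, h1, hs, hnext, D.π_self]

variable (D D') in
lemma exists_chainMap : ∃ ψ : D.M →ₗ[A] D'.M, Homog 0 ψ ∧ (∀ x, D'.d (ψ x) = ψ (D.d x)) ∧
    ∀ x, D'.ε (ψ x) = D.ε x := by
  let _ : Module A k := Module.compHom k (Bialgebra.counitAlgHom k A : A →+* k)
  let εA : ∀ D : Res A k, D.M →ₗ[A] k := fun D =>
    { toFun := D.ε, map_add' := map_add _, map_smul' := D.ε_smul }
  obtain ⟨ψ, hψ⟩ := Module.projective_lifting_property (εA D') (εA D) fun c =>
    ⟨c • D'.η, by change D'.ε _ = c; simp [D'.ε_η]⟩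
  have hψ' : ∀ x, D'.ε (ψ x) = D.ε x := fun x => LinearMap.congr_fun hψ x
  let ψ₀ := D'.π 0 ∘ₗ ψ ∘ₗ D.π 0
  have hd : ∀ x, D'.d (ψ₀ x) = 0 := fun x => by
    simp [ψ₀, D'.d_π, D'.π_of_pos 1 one_pos]
  have h0 : Homog 0 ψ₀ := fun i x => by
    by_cases h : i = 0
    · subst h; simp [ψ₀, D.π_self, D'.π_self]
    · simp [ψ₀, D'.π_of_ne i 0 h, D.π_of_ne 0 i (Ne.symm h)]
  have hε : ∀ x, D'.ε (ψ₀ x) = D.ε x := fun x => by simp [ψ₀, D'.ε_π_zero, hψ', D.ε_π_zero]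
  obtain ⟨h, hh, hε', hG⟩ := exists_homotopy (n := 1) (c := -1) (G := -(ψ₀ ∘ₗ D.d))
    (by simpa using (h0.comp Homog.d).neg) (fun x => by simp [hd, D.d_d])
    (fun x => by simp [hε, D.ε_d])
  refine ⟨ψ₀ - h, h0.sub hh, fun x => ?_, fun x => by simp [hε, hε']⟩
  have := hG x
  simp only [LinearMap.neg_apply, LinearMap.comp_apply, neg_smul, one_smul] at this
  simp only [LinearMap.sub_apply, map_sub, hd]
  rw [neg_eq_iff_eq_neg.mp this]
  abel

end Res

end Resolutions

section Homotopy

namespace Res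

variable {k} {D D' D'' : Res A k}

/-- `F` is a cocycle of degree `n`, that is, a chain map of degree `n`. -/
structure Cocycle (n : ℤ) (F : D.M →ₗ[A] D'.M) : Prop where
  homog : Homog n F
  d_apply : ∀ x, D'.d (F x) = (n.negOnePow : ℤ) • F (D.d x)

/-- `F` is a coboundary of degree `n`, that is, a null-homotopic map of degree `n`. -/
def Bd (n : ℤ) (F : D.M →ₗ[A] D'.M) : Prop :=
  ∃ h : D.M →ₗ[A] D'.M, Homog (n - 1) h ∧
    ∀ x, F x = D'.d (h x) + (n.negOnePow : ℤ) • h (D.d x)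

/-- `φ` is a morphism of resolutions. -/
structure IsAug (φ : D.M →ₗ[A] D'.M) : Prop where
  homog : Homog 0 φ
  d_apply : ∀ x, D'.d (φ x) = φ (D.d x)
  ε_apply : ∀ x, D'.ε (φ x) = D.ε x

lemma Homog.zsmul {n : ℤ} {F : D.M →ₗ[A] D'.M} (hF : Homog n F) (c : ℤ) : Homog n (c • F) :=
  fun i x => by simp [hF i x]

lemma IsAug.cocycle {φ : D.M →ₗ[A] D'.M} (h : IsAug φ) : Cocycle 0 φ :=
  ⟨h.homog, fun x => by simp [h.d_apply]⟩

lemma IsAug.id : IsAug (LinearMap.id : D.M →ₗ[A] D.M) :=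
  ⟨Homog.id, fun _ => rfl, fun _ => rfl⟩

lemma IsAug.comp {ψ : D'.M →ₗ[A] D''.M} {φ : D.M →ₗ[A] D'.M} (hψ : IsAug ψ) (hφ : IsAug φ) :
    IsAug (ψ ∘ₗ φ) :=
  ⟨hψ.homog.comp hφ.homog, fun x => by simp [hψ.d_apply, hφ.d_apply],
    fun x => by simp [hψ.ε_apply, hφ.ε_apply]⟩

variable (D D') in
lemma exists_isAug : ∃ ψ : D.M →ₗ[A] D'.M, IsAug ψ := by
  obtain ⟨ψ, h, h', h''⟩ := exists_chainMap D D'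
  exact ⟨ψ, h, h', h''⟩

lemma Cocycle.of_even {n : ℤ} (hn : Even n) {F : D.M →ₗ[A] D'.M} (hF : Homog n F)
    (hd : ∀ x, D'.d (F x) = F (D.d x)) : Cocycle n F :=
  ⟨hF, fun x => by simp [hd, Int.negOnePow_even n hn]⟩

lemma Cocycle.d_apply_of_even {n : ℤ} (hn : Even n) {F : D.M →ₗ[A] D'.M} (hF : Cocycle n F)
    (x : D.M) : D'.d (F x) = F (D.d x) := by
  simp [hF.d_apply, Int.negOnePow_even n hn]

lemma Cocycle.comp {m n : ℤ} {G : D'.M →ₗ[A] D''.M} {F : D.M →ₗ[A] D'.M} (hG : Cocycle m G)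
    (hF : Cocycle n F) : Cocycle (m + n) (G ∘ₗ F) where
  homog := add_comm n m ▸ hG.homog.comp hF.homog
  d_apply x := by simp [hG.d_apply, hF.d_apply, Int.negOnePow_add, mul_smul]

namespace Bd

variable {m n : ℤ}

lemma zero : Bd n (0 : D.M →ₗ[A] D'.M) := ⟨0, Homog.zero, by simp⟩

lemma add {F F' : D.M →ₗ[A] D'.M} : Bd n F → Bd n F' → Bd n (F + F') := by
  rintro ⟨h, hh, e⟩ ⟨h', hh', e'⟩
  refine ⟨h + h', hh.add hh', fun x => ?_⟩
  simp only [LinearMap.add_apply, e, e', map_add, smul_add]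
  abel

lemma neg {F : D.M →ₗ[A] D'.M} : Bd n F → Bd n (-F) := by
  rintro ⟨h, hh, e⟩
  refine ⟨-h, hh.neg, fun x => ?_⟩
  simp only [LinearMap.neg_apply, e, map_neg, smul_neg]
  abel

lemma sub {F F' : D.M →ₗ[A] D'.M} (h : Bd n F) (h' : Bd n F') : Bd n (F - F') :=
  sub_eq_add_neg F F' ▸ h.add h'.neg

lemma comp_cocycle {F : D'.M →ₗ[A] D''.M} {G : D.M →ₗ[A] D'.M} (hF : Bd m F)
    (hG : Cocycle n G) : Bd (m + n) (F ∘ₗ G) := by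
  obtain ⟨h, hh, e⟩ := hF
  refine ⟨h ∘ₗ G, ?_, fun x => ?_⟩
  · have := hh.comp hG.homog
    rwa [show n + (m - 1) = m + n - 1 by ring] at this
  · simp [e, hG.d_apply, Int.negOnePow_add, mul_smul]

lemma cocycle_comp {F : D.M →ₗ[A] D'.M} {G : D'.M →ₗ[A] D''.M} (hG : Cocycle m G)
    (hF : Bd n F) : Bd (m + n) (G ∘ₗ F) := by
  obtain ⟨h, hh, e⟩ := hF
  refine ⟨(m.negOnePow : ℤ) • G ∘ₗ h, ?_, fun x => ?_⟩
  · have := (hG.homog.comp hh).zsmul m.negOnePow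
    rwa [show n - 1 + m = m + n - 1 by ring] at this
  · have hs : (m.negOnePow : ℤ) * m.negOnePow = 1 := by
      rw [← Units.val_mul, ← Int.negOnePow_add, Int.negOnePow_even _ ⟨m, rfl⟩]; rfl
    simp only [LinearMap.comp_apply, e, map_add, map_zsmul, LinearMap.smul_apply, hG.d_apply,
      smul_smul, Int.negOnePow_add, hs, one_smul, Units.val_mul]
    rw [mul_right_comm, hs, one_mul]

end Bd

lemma IsAug.bd_sub {φ ψ : D.M →ₗ[A] D'.M} (hφ : IsAug φ) (hψ : IsAug ψ) : Bd 0 (φ - ψ) := by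
  obtain ⟨h, hh, -, e⟩ := exists_homotopy (c := 1) (hφ.homog.sub hψ.homog)
    (fun x => by simp [hφ.d_apply, hψ.d_apply]) (fun x => by simp [hφ.ε_apply, hψ.ε_apply])
  exact ⟨h, hh, by simpa using e⟩

end Res

end Homotopy

section Tensor

open HopfAlgebra Coalgebra

namespace Res

variable {k} (D E : Res A k)

/-- The sign operator, `(-1) ^ i` in degree `i`. -/
noncomputable def sgn : D.M →ₗ[A] D.M :=
  asm fun i => (i.negOnePow : ℤ) • (LinearMap.id : D.M →ₗ[A] D.M)

variable {D E}

lemma sgn_π (i : ℤ) (x : D.M) : D.sgn (D.π i x) = (i.negOnePow : ℤ) • D.π i x := asm_π _ i x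

lemma Homog.sgn_apply {D' : Res A k} {n : ℤ} {F : D.M →ₗ[A] D'.M} (hF : Homog n F) (x : D.M) :
    D'.sgn (F x) = (n.negOnePow : ℤ) • F (D.sgn x) := by
  refine ext_π (D'.sgn ∘ₗ F) ((n.negOnePow : ℤ) • F ∘ₗ D.sgn) (fun i y => ?_) x
  simp only [LinearMap.comp_apply, LinearMap.smul_apply, sgn_π, map_zsmul, hF i y]
  rw [Int.negOnePow_add, smul_smul, Units.val_mul, mul_comm]

lemma sgn_d (x : D.M) : D.sgn (D.d x) = -D.d (D.sgn x) := by
  simpa using Homog.d.sgn_apply x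

lemma sgn_s (x : D.M) : D.sgn (D.s x) = -D.s (D.sgn x) := by
  refine ext_π (D.sgn.toAddMonoidHom.comp D.s.toAddMonoidHom)
    (-(D.s.toAddMonoidHom.comp D.sgn.toAddMonoidHom)) (fun i y => ?_) x
  change D.sgn (D.s (D.π i y)) = -D.s (D.sgn (D.π i y))
  simp [sgn_π, D.s_π, Int.negOnePow_sub]

lemma ε_sgn (x : D.M) : D.ε (D.sgn x) = D.ε x := by
  refine ext_π (D.ε.toAddMonoidHom.comp D.sgn.toAddMonoidHom) D.ε.toAddMonoidHom (fun i y => ?_) x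
  change D.ε (D.sgn (D.π i y)) = D.ε (D.π i y)
  by_cases hi : i = 0
  · subst hi; simp [sgn_π]
  · simp [sgn_π, ε_π_of_ne hi]

lemma sgn_η : D.sgn D.η = D.η := by
  rw [← D.π_zero_η, sgn_π]; simp

/-- The degree `n` projection of the tensor product. -/
noncomputable def tensorπ (D E : Res A k) (n : ℤ) : Diag A k D.M E.M →ₗ[A] Diag A k D.M E.M :=
  ∑ i ∈ Finset.Icc n 0, Diag.map (D.π i) (E.π (n - i))

lemma tensorπ_tmul (n i j : ℤ) (x : D.M) (y : E.M) :
    tensorπ D E n (Diag.tmul A k (D.π i x) (E.π j y)) =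
      if i + j = n then Diag.tmul A k (D.π i x) (E.π j y) else 0 := by
  have key : ∀ l, Diag.map (k := k) (D.π l) (E.π (n - l)) (Diag.tmul A k (D.π i x) (E.π j y)) =
      if l = i ∧ i + j = n then Diag.tmul A k (D.π i x) (E.π j y) else 0 := fun l => by
    rw [Diag.map_tmul]
    split_ifs with h
    · obtain ⟨rfl, rfl⟩ := h
      rw [D.π_self, add_sub_cancel_left, E.π_self]
    · by_cases hl : l = i
      · rw [E.π_of_ne (n - l) j (fun h' => h ⟨hl, by omega⟩), Diag.tmul_zero]
      · rw [D.π_of_ne l i hl, Diag.zero_tmul]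
  rw [tensorπ, LinearMap.sum_apply, Finset.sum_congr rfl fun l _ => key l]
  by_cases h : i + j = n
  · simp only [h, and_true, Finset.sum_ite_eq', Finset.mem_Icc]
    by_cases hi : 0 < i
    · simp [D.π_of_pos i hi]
    by_cases hj : 0 < j
    · simp [E.π_of_pos j hj]
    · rw [if_pos ⟨by omega, by omega⟩, if_pos trivial]
  · simp [h]

lemma tensor_mem (p : AddSubgroup (Diag A k D.M E.M))
    (h : ∀ i j x y, Diag.tmul A k (D.π i x) (E.π j y) ∈ p) (t : Diag A k D.M E.M) : t ∈ p := by
  refine Diag.addSubgroup_eq_top (fun x y => ?_) t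
  let f : D.M →+ E.M →+ Diag A k D.M E.M :=
    AddMonoidHom.mk' (fun x => AddMonoidHom.mk' (fun y => Diag.tmul A k x y) (Diag.tmul_add x))
      fun x x' => AddMonoidHom.ext fun y => Diag.add_tmul x x' y
  refine D.mem_of_π_mem (p.comap (f.flip y)) (fun i x => ?_) x
  exact E.mem_of_π_mem (p.comap (f (D.π i x))) (fun j y => h i j x y) y

/-- Additive maps that agree on tensors of homogeneous elements agree. -/
lemma tensor_ext {G F₁ F₂ : Type*} [AddCommGroup G] [FunLike F₁ (Diag A k D.M E.M) G]
    [AddMonoidHomClass F₁ (Diag A k D.M E.M) G] [FunLike F₂ (Diag A k D.M E.M) G]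
    [AddMonoidHomClass F₂ (Diag A k D.M E.M) G] (f : F₁) (g : F₂)
    (h : ∀ i j x y, f (Diag.tmul A k (D.π i x) (E.π j y)) = g (Diag.tmul A k (D.π i x) (E.π j y)))
    (t : Diag A k D.M E.M) : f t = g t :=
  tensor_mem ((f : Diag A k D.M E.M →+ G).eqLocus (g : Diag A k D.M E.M →+ G)) h t

/-- The contracting homotopy of the tensor product. -/
noncomputable def tensorS (D E : Res A k) : Diag A k D.M E.M →ₗ[k] Diag A k D.M E.M :=
  (TensorProduct.map D.s LinearMap.id +
    TensorProduct.map (LinearMap.toSpanSingleton k D.M D.η ∘ₗ D.ε) E.s : _ →ₗ[k] D.M ⊗[k] E.M)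

lemma tensorS_tmul (x : D.M) (y : E.M) : tensorS D E (Diag.tmul A k x y) =
    Diag.tmul A k (D.s x) y + D.ε x • Diag.tmul A k D.η (E.s y) := by
  rw [← Diag.smul_tmul']; rfl

/-- The differential of the tensor product. -/
noncomputable def tensorD (D E : Res A k) : Diag A k D.M E.M →ₗ[A] Diag A k D.M E.M :=
  Diag.map D.d LinearMap.id + Diag.map D.sgn E.d

lemma tensorD_tmul (x : D.M) (y : E.M) : tensorD D E (Diag.tmul A k x y) =
    Diag.tmul A k (D.d x) y + Diag.tmul A k (D.sgn x) (E.d y) := rfl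

/-- The tensor product of two resolutions, with `A` acting diagonally. -/
noncomputable def tensor (D E : Res A k) : Res A k where
  M := Diag A k D.M E.M
  projective := Diag.projective
  π := tensorπ D E
  π_self n x := by
    refine tensor_ext (tensorπ D E n ∘ₗ tensorπ D E n) (tensorπ D E n) (fun i j x y => ?_) x
    simp only [LinearMap.comp_apply, tensorπ_tmul]
    split_ifs with h <;> simp [tensorπ_tmul, h]
  π_of_ne m n hmn x := by
    refine tensor_ext (tensorπ D E m ∘ₗ tensorπ D E n) (0 : _ →ₗ[A] Diag A k D.M E.M)
      (fun i j x y => ?_) x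
    simp only [LinearMap.comp_apply, tensorπ_tmul]
    split_ifs with h
    · simp [tensorπ_tmul, h, hmn.symm]
    · simp
  π_of_pos n hn x := by simp [tensorπ, Finset.Icc_eq_empty (not_le.mpr hn)]
  mem_of_π_mem p hp x := tensor_mem p (fun i j x y => by
    have := hp (i + j) (Diag.tmul A k (D.π i x) (E.π j y))
    rwa [tensorπ_tmul, if_pos rfl] at this) x
  d := tensorD D E
  d_d x := by
    refine Diag.induction_tmul (tensorD D E ∘ₗ tensorD D E) (0 : _ →ₗ[A] Diag A k D.M E.M)
      (fun x y => ?_) x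
    simp [tensorD_tmul, D.d_d, E.d_d, sgn_d, Diag.neg_tmul]
  d_π n x := by
    refine tensor_ext (tensorD D E ∘ₗ tensorπ D E n)
      (tensorπ D E (n + 1) ∘ₗ tensorD D E)
      (fun i j x y => ?_) x
    simp only [LinearMap.comp_apply, tensorπ_tmul, tensorD_tmul, map_add, D.d_π, E.d_π, sgn_π,
      ← map_zsmul (D.π i)]
    by_cases h : i + j = n
    · rw [if_pos h, if_pos (by omega), if_pos (by omega)]
      simp [tensorD_tmul, sgn_π, D.d_π, E.d_π]
    · rw [if_neg h, if_neg (by omega), if_neg (by omega)]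
      simp
  ε := D.ε ∘ₗ (Diag.counitRight (A := A) E.ε E.ε_smul).restrictScalars k
  ε_smul a x := by simp [D.ε_smul]
  ε_d x := by
    refine Diag.induction_tmul ((D.ε.toAddMonoidHom.comp
      (Diag.counitRight (A := A) E.ε E.ε_smul).toAddMonoidHom).comp
      (tensorD D E).toAddMonoidHom) (0 : _ →+ k)
      (fun x y => ?_) x
    change D.ε (Diag.counitRight (A := A) E.ε E.ε_smul
      (Diag.tmul A k (D.d x) y + Diag.tmul A k (D.sgn x) (E.d y))) = 0
    simp [E.ε_d, D.ε_d]
  ε_π_zero x := by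
    refine tensor_ext ((D.ε.toAddMonoidHom.comp
      (Diag.counitRight (A := A) E.ε E.ε_smul).toAddMonoidHom).comp
      (tensorπ D E 0).toAddMonoidHom) (D.ε.toAddMonoidHom.comp
      (Diag.counitRight (A := A) E.ε E.ε_smul).toAddMonoidHom)
      (fun i j x y => ?_) x
    change D.ε (Diag.counitRight (A := A) E.ε E.ε_smul (tensorπ D E 0 (Diag.tmul A k _ _))) =
      D.ε (Diag.counitRight (A := A) E.ε E.ε_smul (Diag.tmul A k _ _))
    rw [tensorπ_tmul]
    split_ifs with h
    · rfl
    · by_cases hi : i = 0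
      · rw [Diag.counitRight_tmul, ε_π_of_ne (by omega)]; simp
      · rw [Diag.counitRight_tmul, map_smul, ε_π_of_ne hi]; simp
  η := Diag.tmul A k D.η E.η
  ε_η := by simp [D.ε_η, E.ε_η]
  π_zero_η := by
    rw [← D.π_zero_η, ← E.π_zero_η, tensorπ_tmul, if_pos (by norm_num)]
  s := tensorS D E
  s_π n x := by
    refine tensor_ext ((tensorS D E).toAddMonoidHom.comp (tensorπ D E n).toAddMonoidHom)
      ((tensorπ D E (n - 1)).toAddMonoidHom.comp (tensorS D E).toAddMonoidHom)
      (fun i j x y => ?_) x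
    change tensorS D E (tensorπ D E n (Diag.tmul A k _ _)) =
      tensorπ D E (n - 1) (tensorS D E (Diag.tmul A k _ _))
    rw [tensorπ_tmul, tensorS_tmul, D.s_π, E.s_π, map_add, tensorπ_tmul]
    have h2 : tensorπ D E (n - 1) (D.ε (D.π i x) • Diag.tmul A k D.η (E.π (j - 1) (E.s y))) =
        if i + j = n then D.ε (D.π i x) • Diag.tmul A k D.η (E.π (j - 1) (E.s y)) else 0 := by
      rw [LinearMap.map_smul_of_tower]
      by_cases hi : i = 0
      · subst hi
        conv_lhs => rw [← D.π_zero_η, tensorπ_tmul]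
        rw [D.π_zero_η]
        split_ifs <;> first | omega | simp
      · simp [ε_π_of_ne hi]
    rw [h2]
    by_cases h : i + j = n
    · rw [if_pos h, if_pos (by omega), if_pos h, tensorS_tmul, D.s_π, E.s_π]
    · rw [if_neg h, if_neg (by omega), if_neg h]; simp
  d_s x := by
    refine Diag.induction_tmul
      ((tensorD D E).toAddMonoidHom.comp
        (tensorS D E).toAddMonoidHom + (tensorS D E).toAddMonoidHom.comp
        (tensorD D E).toAddMonoidHom)
      (AddMonoidHom.id _ - (LinearMap.toSpanSingleton k _ (Diag.tmul A k D.η E.η) ∘ₗ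
        (D.ε ∘ₗ (Diag.counitRight (A := A) E.ε E.ε_smul).restrictScalars k)).toAddMonoidHom)
      (fun x y => ?_) x
    change tensorD D E (tensorS D E (Diag.tmul A k x y)) +
      tensorS D E (Diag.tmul A k (D.d x) y + Diag.tmul A k (D.sgn x) (E.d y)) =
      Diag.tmul A k x y - D.ε (Diag.counitRight (A := A) E.ε E.ε_smul (Diag.tmul A k x y)) •
        Diag.tmul A k D.η E.η
    have h1 := congrArg (fun z => Diag.tmul A k z y) (D.d_s x)
    have h2 := congrArg (fun z => D.ε x • Diag.tmul A k D.η z) (E.d_s y)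
    simp only [Diag.add_tmul, Diag.tmul_add, Diag.sub_tmul, Diag.tmul_sub, smul_add, smul_sub,
      Diag.smul_tmul', Diag.tmul_smul] at h1 h2
    simp only [tensorS_tmul, map_add, LinearMap.map_smul_of_tower, tensorD_tmul, D.ε_d, ε_sgn,
      sgn_s, sgn_η, d_η, Diag.neg_tmul,
      zero_smul, Diag.zero_tmul, Diag.counitRight_tmul, map_smul, smul_eq_mul]
    rw [eq_sub_iff_add_eq] at h1
    rw [← h1, mul_comm, mul_smul]
    rw [smul_smul, mul_smul] at h2
    rw [zero_add, eq_sub_of_add_eq h2]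
    abel

end Res

end Tensor

section Commuting

namespace Res

variable {k} {D E D' : Res A k}

/-- The pure tensor `x ⊗ y`, as an element of the tensor product resolution. -/
def pure (x : D.M) (y : E.M) : (tensor D E).M := Diag.tmul A k x y

lemma pure_ext {G F₁ F₂ : Type*} [AddCommGroup G] [FunLike F₁ (tensor D E).M G]
    [AddMonoidHomClass F₁ (tensor D E).M G] [FunLike F₂ (tensor D E).M G]
    [AddMonoidHomClass F₂ (tensor D E).M G] (f : F₁) (g : F₂)
    (h : ∀ x y, f (pure x y) = g (pure x y)) (t : (tensor D E).M) : f t = g t :=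
  Diag.addSubgroup_eq_top
    (p := (f : (tensor D E).M →+ G).eqLocus (g : (tensor D E).M →+ G)) h t

lemma pure_ext_π {G F₁ F₂ : Type*} [AddCommGroup G] [FunLike F₁ (tensor D E).M G]
    [AddMonoidHomClass F₁ (tensor D E).M G] [FunLike F₂ (tensor D E).M G]
    [AddMonoidHomClass F₂ (tensor D E).M G] (f : F₁) (g : F₂)
    (h : ∀ i j x y, f (pure (D.π i x) (E.π j y)) = g (pure (D.π i x) (E.π j y)))
    (t : (tensor D E).M) : f t = g t :=
  tensor_mem ((f : (tensor D E).M →+ G).eqLocus (g : (tensor D E).M →+ G)) h t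

lemma tensor_π_tmul (n i j : ℤ) (x : D.M) (y : E.M) :
    (tensor D E).π n (pure (D.π i x) (E.π j y)) =
      if i + j = n then pure (D.π i x) (E.π j y) else 0 :=
  tensorπ_tmul n i j x y

lemma tensor_d_tmul (x : D.M) (y : E.M) : (tensor D E).d (pure x y) =
    pure (D.d x) y + pure (D.sgn x) (E.d y) := rfl

/-- The operator `F ⊗ G` on the tensor product of two resolutions. -/
noncomputable def tensorMap (F : D.M →ₗ[A] D.M) (G : E.M →ₗ[A] E.M) :
    (tensor D E).M →ₗ[A] (tensor D E).M := Diag.map F G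

lemma tensorMap_tmul (F : D.M →ₗ[A] D.M) (G : E.M →ₗ[A] E.M) (x : D.M) (y : E.M) :
    tensorMap F G (pure x y) = pure (F x) (G y) := rfl

lemma Cocycle.tensorMap {a b : ℤ} (ha : Even a) (hb : Even b) {F : D.M →ₗ[A] D.M}
    {G : E.M →ₗ[A] E.M} (hF : Cocycle a F) (hG : Cocycle b G) :
    Cocycle (a + b) (tensorMap F G) := by
  refine Cocycle.of_even (ha.add hb) (fun n t => ?_) fun t => ?_
  · refine pure_ext_π (Res.tensorMap F G ∘ₗ (tensor D E).π n)
      ((tensor D E).π (n + (a + b)) ∘ₗ Res.tensorMap F G) (fun i j x y => ?_) t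
    simp only [LinearMap.comp_apply, tensor_π_tmul, tensorMap_tmul, hF.homog i x, hG.homog j y]
    by_cases h : i + j = n
    · rw [if_pos h, if_pos (by omega), tensorMap_tmul, hF.homog i x, hG.homog j y]
    · rw [if_neg h, if_neg (by omega), map_zero]
  · refine pure_ext ((tensor D E).d ∘ₗ Res.tensorMap F G)
      (Res.tensorMap F G ∘ₗ (tensor D E).d) (fun x y => ?_) t
    have h := hF.homog.sgn_apply x
    rw [Int.negOnePow_even a ha, Units.val_one, one_smul] at h
    simp only [LinearMap.comp_apply, tensorMap_tmul, tensor_d_tmul, map_add,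
      hF.d_apply_of_even ha, hG.d_apply_of_even hb, h]

/-- The projection `1 ⊗ ε`. -/
noncomputable def tensorFst (D E : Res A k) : (tensor D E).M →ₗ[A] D.M :=
  Diag.counitRight E.ε E.ε_smul

/-- The projection `ε ⊗ 1`. -/
noncomputable def tensorSnd (D E : Res A k) : (tensor D E).M →ₗ[A] E.M :=
  Diag.counitLeft D.ε D.ε_smul

lemma tensorFst_tmul (x : D.M) (y : E.M) : tensorFst D E (pure x y) = E.ε y • x :=
  Diag.counitRight_tmul _ _ x y

lemma tensorSnd_tmul (x : D.M) (y : E.M) : tensorSnd D E (pure x y) = D.ε x • y :=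
  Diag.counitLeft_tmul _ _ x y

lemma isAug_tensorFst : IsAug (tensorFst D E) where
  homog n t := by
    refine pure_ext_π (tensorFst D E ∘ₗ (tensor D E).π n) (D.π (n + 0) ∘ₗ tensorFst D E)
      (fun i j x y => ?_) t
    simp only [LinearMap.comp_apply, tensor_π_tmul, tensorFst_tmul, add_zero,
      LinearMap.map_smul_of_tower]
    by_cases hj : j = 0
    · by_cases hi : i = n
      · rw [if_pos (by omega), tensorFst_tmul, hi, D.π_self]
      · rw [if_neg (by omega), D.π_of_ne n i (Ne.symm hi), map_zero, smul_zero]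
    · rw [ε_π_of_ne hj, zero_smul]
      split_ifs
      · rw [tensorFst_tmul, ε_π_of_ne hj, zero_smul]
      · rw [map_zero]
  d_apply t := by
    refine pure_ext (D.d ∘ₗ tensorFst D E) (tensorFst D E ∘ₗ (tensor D E).d)
      (fun x y => ?_) t
    simp [tensorFst_tmul, tensor_d_tmul, E.ε_d, LinearMap.map_smul_of_tower]
  ε_apply t := rfl

lemma isAug_tensorSnd : IsAug (tensorSnd D E) where
  homog n t := by
    refine pure_ext_π (tensorSnd D E ∘ₗ (tensor D E).π n) (E.π (n + 0) ∘ₗ tensorSnd D E)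
      (fun i j x y => ?_) t
    simp only [LinearMap.comp_apply, tensor_π_tmul, tensorSnd_tmul, add_zero,
      LinearMap.map_smul_of_tower]
    by_cases hi : i = 0
    · by_cases hj : j = n
      · rw [if_pos (by omega), tensorSnd_tmul, hj, E.π_self]
      · rw [if_neg (by omega), E.π_of_ne n j (Ne.symm hj), map_zero, smul_zero]
    · rw [ε_π_of_ne hi, zero_smul]
      split_ifs
      · rw [tensorSnd_tmul, ε_π_of_ne hi, zero_smul]
      · rw [map_zero]
  d_apply t := by
    refine pure_ext (E.d ∘ₗ tensorSnd D E) (tensorSnd D E ∘ₗ (tensor D E).d)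
      (fun x y => ?_) t
    simp [tensorSnd_tmul, tensor_d_tmul, D.ε_d, ε_sgn, LinearMap.map_smul_of_tower]
  ε_apply t := by
    refine pure_ext (E.ε.toAddMonoidHom.comp (tensorSnd D E).toAddMonoidHom)
      (D.ε.toAddMonoidHom.comp (tensorFst D E).toAddMonoidHom) (fun x y => ?_) t
    change E.ε (tensorSnd D E (pure x y)) = D.ε (tensorFst D E (pure x y))
    simp [tensorSnd_tmul, tensorFst_tmul, mul_comm]

/-- If `F` corresponds to `X` up to homotopy under one morphism of resolutions, then it does so
under all of them. -/
lemma Bd.of_isAug {n : ℤ} {F : D.M →ₗ[A] D.M} {X : D'.M →ₗ[A] D'.M} (hF : Cocycle n F)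
    (hX : Cocycle n X) {φ ψ : D.M →ₗ[A] D'.M} (hφ : IsAug φ) (hψ : IsAug ψ)
    (h : Bd n (φ ∘ₗ F - X ∘ₗ φ)) : Bd n (ψ ∘ₗ F - X ∘ₗ ψ) := by
  have h₁ := (hψ.bd_sub hφ).comp_cocycle hF
  have h₂ := Bd.cocycle_comp hX (hφ.bd_sub hψ)
  rw [zero_add] at h₁
  rw [add_zero] at h₂
  have := (h₁.add h).add h₂
  rwa [LinearMap.sub_comp, LinearMap.comp_sub, sub_add_sub_cancel, sub_add_sub_cancel] at this

/-- Cocycles of even degree can be made to commute strictly after passing to another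
resolution. -/
lemma exists_commuting (D' : Res A k) : ∀ (N : ℕ) (w : Fin N → ℤ) (_ : ∀ i, Even (w i))
    (X : Fin N → D'.M →ₗ[A] D'.M) (_ : ∀ i, Cocycle (w i) (X i)),
    ∃ (D : Res A k) (F : Fin N → D.M →ₗ[A] D.M), (∀ i, Cocycle (w i) (F i)) ∧
      (∀ i j y, F i (F j y) = F j (F i y)) ∧
      ∀ φ : D.M →ₗ[A] D'.M, IsAug φ → ∀ i, Bd (w i) (φ ∘ₗ F i - X i ∘ₗ φ)
  | 0, _, _, _, _ => ⟨D', Fin.elim0, fun i => i.elim0, fun i => i.elim0, fun _ _ i => i.elim0⟩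
  | N + 1, w, hw, X, hX => by
    obtain ⟨D, F, hF, hcomm, hbd⟩ := exists_commuting D' N (fun i => w i.succ)
      (fun i => hw i.succ) (fun i => X i.succ) fun i => hX i.succ
    have h0 : Cocycle (w 0) (tensorMap (LinearMap.id : D.M →ₗ[A] D.M) (X 0)) :=
      zero_add (w 0) ▸ IsAug.id.cocycle.tensorMap Even.zero (hw 0) (hX 0)
    have hs : ∀ i, Cocycle (w (Fin.succ i))
        (tensorMap (F i) (LinearMap.id : D'.M →ₗ[A] D'.M)) := fun i =>
      add_zero (w i.succ) ▸ (hF i).tensorMap (hw _) Even.zero IsAug.id.cocycle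
    have hc : ∀ i y, tensorMap (LinearMap.id : D.M →ₗ[A] D.M) (X 0)
        (tensorMap (F i) (LinearMap.id : D'.M →ₗ[A] D'.M) y) =
        tensorMap (F i) (LinearMap.id : D'.M →ₗ[A] D'.M)
          (tensorMap (LinearMap.id : D.M →ₗ[A] D.M) (X 0) y) := fun i y =>
      pure_ext (tensorMap (LinearMap.id : D.M →ₗ[A] D.M) (X 0) ∘ₗ
        tensorMap (F i) (LinearMap.id : D'.M →ₗ[A] D'.M))
        (tensorMap (F i) (LinearMap.id : D'.M →ₗ[A] D'.M) ∘ₗ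
          tensorMap (LinearMap.id : D.M →ₗ[A] D.M) (X 0)) (fun _ _ => rfl) y
    refine ⟨tensor D D', Fin.cons (tensorMap LinearMap.id (X 0))
      fun i => tensorMap (F i) LinearMap.id, fun i => ?_, fun i j y => ?_, fun φ hφ i => ?_⟩
    · refine Fin.cases ?_ (fun i => ?_) i
      · exact h0
      · exact hs i
    · refine Fin.cases ?_ (fun i => ?_) i <;> refine Fin.cases ?_ (fun j => ?_) j
      · rfl
      · exact hc j y
      · exact (hc i y).symm
      · exact pure_ext (tensorMap (F i) (LinearMap.id : D'.M →ₗ[A] D'.M) ∘ₗ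
          tensorMap (F j) (LinearMap.id : D'.M →ₗ[A] D'.M))
          (tensorMap (F j) (LinearMap.id : D'.M →ₗ[A] D'.M) ∘ₗ
          tensorMap (F i) (LinearMap.id : D'.M →ₗ[A] D'.M))
          (fun x z => congrArg (fun x => pure (D := D) (E := D') x z) (hcomm i j x)) y
    · refine Fin.cases ?_ (fun i => ?_) i
      · refine Bd.of_isAug h0 (hX 0) isAug_tensorSnd hφ ?_
        convert Bd.zero using 1
        ext t
        refine pure_ext (tensorSnd D D' ∘ₗ tensorMap LinearMap.id (X 0) -
          X 0 ∘ₗ tensorSnd D D') (0 : _ →ₗ[A] D'.M) (fun x y => ?_) t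
        simp [tensorMap_tmul, tensorSnd_tmul, LinearMap.map_smul_of_tower]
      · obtain ⟨ψ, hψ⟩ := exists_isAug D D'
        refine Bd.of_isAug (hs i) (hX _) (hψ.comp isAug_tensorFst) hφ ?_
        have h := (hbd ψ hψ i).comp_cocycle (isAug_tensorFst (D := D) (E := D')).cocycle
        rw [add_zero] at h
        convert h using 1
        ext t
        refine pure_ext ((ψ ∘ₗ tensorFst D D') ∘ₗ tensorMap (F i) LinearMap.id -
          X i.succ ∘ₗ ψ ∘ₗ tensorFst D D') ((ψ ∘ₗ F i - X i.succ ∘ₗ ψ) ∘ₗ tensorFst D D')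
          (fun x y => ?_) t
        simp [tensorMap_tmul, tensorFst_tmul, LinearMap.map_smul_of_tower]

end Res

end Commuting

section Realization

open HopfAlgebra Coalgebra

instance (P : ZComplex A) (i : ℤ) : IsScalarTower k A (P.X i) where
  smul_assoc c a x := by
    rw [Algebra.smul_def, mul_smul]
    rfl

/-- The identification of the terms of the complex `P` with the homogeneous pieces of `D`. -/
structure Realizes (P : ZComplex A) (D : Res A k) where
  ι : ∀ i, P.X i →ₗ[A] D.M
  p : ∀ i, D.M →ₗ[A] P.X i
  p_ι : ∀ i x, p i (ι i x) = x
  ι_p : ∀ i x, ι i (p i x) = D.π i x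
  ι_d : ∀ i j h x, ι j (P.d i j h x) = D.d (ι i x)

variable {k}

open DirectSum in
lemma IsTrivResolution.exists_realizes {P : ZComplex A} {ε : P.X 0 →ₗ[A] TrivMod k A}
    (h : IsTrivResolution k P ε) : ∃ D : Res A k, Nonempty (Realizes k P D) := by
  classical
  have := h.projective
  let M := ⨁ i, P.X i
  let ι : ∀ i, P.X i →ₗ[A] M := fun i => DirectSum.lof A ℤ (fun i => P.X i) i
  let p : ∀ i, M →ₗ[A] P.X i := fun i => DirectSum.component A ℤ (fun i => P.X i) i
  have p_ι : ∀ i x, p i (ι i x) = x := fun i x => DirectSum.component.lof_self A i x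
  have p_ι' : ∀ i j, i ≠ j → ∀ x, p i (ι j x) = 0 := fun i j hij x => by
    rw [DirectSum.component.of, dif_neg hij.symm]
  let d : M →ₗ[A] M := DirectSum.toModule A ℤ M fun i => ι (i + 1) ∘ₗ P.d i (i + 1) rfl
  have d_ι : ∀ i j hij x, d (ι i x) = ι j (P.d i j hij x) := fun i j hij x => by
    subst hij
    exact DirectSum.toModule_lof A i x
  let ε' : P.X 0 →ₗ[k] k :=
    { toFun := ε
      map_add' := map_add ε
      map_smul' := fun c x => by
        have : ε (c • x) = algebraMap k A c • ε x := map_smul ε (algebraMap k A c) x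
        refine this.trans ?_
        change counit (R := k) (algebraMap k A c) * (show k from ε x) = c * (show k from ε x)
        rw [Bialgebra.counit_algebraMap] }
  let π : ∀ i, M →ₗ[A] M := fun i => ι i ∘ₗ p i
  let εM : M →ₗ[k] k := ε' ∘ₗ (p 0).restrictScalars k
  have hεM : ∀ x, εM x = ε (p 0 x) := fun x => rfl
  obtain ⟨e, he⟩ := h.surj (1 : k)
  have mem_of_mem : ∀ q : AddSubgroup M, (∀ i x, ι i x ∈ q) → ∀ x, x ∈ q := fun q hq x =>
    DirectSum.induction_on x q.zero_mem hq fun _ _ => q.add_mem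
  have hext : ∀ f g : M →+ M, (∀ i x, f (ι i x) = g (ι i x)) → ∀ x, f x = g x :=
    fun f g hfg => mem_of_mem (f.eqLocus g) hfg
  have π_self : ∀ i x, π i (π i x) = π i x := fun i x => congrArg (ι i) (p_ι i _)
  have π_of_ne : ∀ i j, i ≠ j → ∀ x, π i (π j x) = 0 := fun i j hij x => by
    simp [π, p_ι' i j hij]
  have π_of_pos : ∀ i, 0 < i → ∀ x, π i x = 0 := fun i hi x => by
    have := h.zero_of_pos i hi
    simp [π, Subsingleton.elim (p i x) 0]
  have mem_of_π_mem : ∀ q : AddSubgroup M, (∀ i x, π i x ∈ q) → ∀ x, x ∈ q :=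
    fun q hq => mem_of_mem q fun i x => by simpa [π, p_ι] using hq i (ι i x)
  have d_d : ∀ x, d (d x) = 0 := hext (d.toAddMonoidHom.comp d.toAddMonoidHom) 0 fun i x => by
    change d (d (ι i x)) = 0
    rw [d_ι i _ rfl, d_ι _ _ rfl, ← LinearMap.comp_apply (P.d _ _ _), P.d_comp_d]
    simp
  have d_π : ∀ i x, d (π i x) = π (i + 1) (d x) := fun i =>
    hext (d.toAddMonoidHom.comp (π i).toAddMonoidHom)
      ((π (i + 1)).toAddMonoidHom.comp d.toAddMonoidHom) fun j x => by
    change d (ι i (p i (ι j x))) = ι (i + 1) (p (i + 1) (d (ι j x)))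
    rw [d_ι j _ rfl]
    by_cases hij : i = j
    · subst hij; rw [p_ι, p_ι, d_ι i _ rfl]
    · rw [p_ι' i j hij, p_ι' _ _ (by omega)]; simp
  have ε_d : ∀ x, εM (d x) = 0 := by
    refine mem_of_mem ((εM.toAddMonoidHom.comp d.toAddMonoidHom).eqLocus 0) fun i x => ?_
    change ε (p 0 (d (ι i x))) = (0 : k)
    by_cases hi : i = -1
    · subst hi
      rw [d_ι _ 0 (by norm_num), p_ι]
      exact (h.exact_at_zero _).mpr ⟨x, rfl⟩
    · rw [d_ι _ _ rfl, p_ι' _ _ (by omega), map_zero]; rfl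
  have ε_π_zero : ∀ x, εM (π 0 x) = εM x := fun x => congrArg ε (p_ι 0 _)
  have ε_η : εM (ι 0 e) = 1 := (congrArg ε (p_ι 0 _)).trans he
  have π_zero_η : π 0 (ι 0 e) = ι 0 e := congrArg (ι 0) (p_ι 0 _)
  have p_d : ∀ i j hij x, p j (d x) = P.d i j hij (p i x) := fun i j hij x => by
    have := congrArg (p j) (d_π i x)
    subst hij
    simpa [π, p_ι, d_ι _ _ rfl] using this.symm
  have hexact : ∀ x, d x = 0 → εM x = 0 → ∃ y, d y = x := fun x hx hεx => by
    suffices x ∈ LinearMap.range d from this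
    rw [← DirectSum.sum_support_of x]
    refine Submodule.sum_mem _ fun i _ => ?_
    change ι i (p i x) ∈ _
    have hdx : P.d i (i + 1) rfl (p i x) = 0 := by rw [← p_d, hx, map_zero]
    rcases lt_trichotomy i 0 with hi | rfl | hi
    · obtain ⟨y, hy⟩ := (h.exact_at_neg i hi _).mp hdx
      exact ⟨ι (i - 1) y, by rw [d_ι _ i (by omega), hy]⟩
    · obtain ⟨y, hy⟩ := (h.exact_at_zero _).mp hεx
      exact ⟨ι (-1) y, (d_ι _ 0 (by omega) y).trans (congrArg (ι 0) hy)⟩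
    · have := π_of_pos i hi x
      exact ⟨0, by rw [map_zero]; exact this.symm⟩
  obtain ⟨s, s_π, d_s⟩ := exists_contraction (K := k) (π := fun i => (π i).restrictScalars k)
    (d := d.restrictScalars k) π_self π_of_ne π_of_pos mem_of_π_mem d_d d_π ε_d ε_π_zero ε_η
    π_zero_η hexact
  have ε_smul : ∀ (a : A) x, εM (a • x) = counit (R := k) a * εM x := fun a x => by
    rw [hεM, map_smul, map_smul]; rfl
  have ι_p : ∀ i x, ι i (p i x) = π i x := fun i x => rfl
  let D : Res A k :=
    { M := M, π, π_self, π_of_ne, π_of_pos, mem_of_π_mem, d, d_d, d_π, ε := εM, ε_smul, ε_d,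
      ε_π_zero, η := ι 0 e, ε_η, π_zero_η, s, s_π, d_s }
  exact ⟨D, ⟨⟨ι, p, p_ι, ι_p, fun i j hij x => (d_ι i j hij x).symm⟩⟩⟩

namespace Res

/-- The complex of homogeneous pieces of `D`. -/
noncomputable def toZComplex (D : Res A k) : ZComplex A where
  X i := LinearMap.range (D.π i)
  d i j h := (D.d ∘ₗ (LinearMap.range (D.π i)).subtype).codRestrict (LinearMap.range (D.π j)) (by
    rintro ⟨_, x, rfl⟩
    exact ⟨D.d x, by subst h; exact (D.d_π i x).symm⟩)
  d_comp_d i j l hij hjl := by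
    ext x
    exact D.d_d _

lemma π_coe (D : Res A k) {i : ℤ} (x : LinearMap.range (D.π i)) : D.π i x = x := by
  obtain ⟨_, y, rfl⟩ := x
  exact D.π_self i y

/-- The complex of homogeneous pieces of `D` realizes `D`. -/
noncomputable def realizes (D : Res A k) : Realizes k D.toZComplex D where
  ι i := (LinearMap.range (D.π i)).subtype
  p i := (D.π i).rangeRestrict
  p_ι _ x := Subtype.ext (D.π_coe x)
  ι_p _ _ := rfl
  ι_d _ _ _ _ := rfl

/-- The augmentation of the complex of homogeneous pieces of `D`. -/
noncomputable def augmentation (D : Res A k) : D.toZComplex.X 0 →ₗ[A] TrivMod k A where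
  toFun x := D.ε (D.realizes.ι 0 x)
  map_add' x y := by rw [map_add, map_add]; rfl
  map_smul' a x := by rw [map_smul, D.ε_smul]; rfl

lemma exists_d_eq (D : Res A k) {i j : ℤ} (hij : i + 1 = j) (x : LinearMap.range (D.π j))
    (hd : D.d x = 0) (hε : D.ε x = 0) :
    ∃ y, D.toZComplex.d i j hij y = x := by
  have hπ : D.π i (D.s x) = D.s x := by rw [π_s, hij, π_coe]
  exact ⟨⟨D.s x, D.s x, hπ⟩, Subtype.ext (d_s_of_d_eq_zero hd hε)⟩

lemma isTrivResolution (D : Res A k) : IsTrivResolution k D.toZComplex D.augmentation where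
  projective i := Module.Projective.of_split (D.realizes.ι i) (D.realizes.p i)
    (LinearMap.ext (D.realizes.p_ι i))
  zero_of_pos i hi := ⟨fun x y => Subtype.ext (by
    rw [← D.π_coe x, ← D.π_coe y, D.π_of_pos i hi, D.π_of_pos i hi])⟩
  surj := fun (c : k) => ⟨⟨c • D.η, c • D.η, by
    rw [LinearMap.map_smul_of_tower, D.π_zero_η]⟩, by
    change D.ε (c • D.η) = c
    rw [map_smul, D.ε_η, smul_eq_mul, mul_one]⟩
  exact_at_zero := fun (x : LinearMap.range (D.π 0)) => by
    refine ⟨fun hx => D.exists_d_eq _ x ?_ hx, ?_⟩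
    · rw [← D.π_coe x, D.d_π, D.π_of_pos _ (by norm_num)]
    · rintro ⟨y, hy⟩
      rw [← hy]
      exact D.ε_d (D.realizes.ι (-1) y)
  exact_at_neg i hi := fun (x : LinearMap.range (D.π i)) => by
    refine ⟨fun hx => D.exists_d_eq _ x (congrArg Subtype.val hx) ?_, ?_⟩
    · rw [← D.π_coe x, ε_π_of_ne hi.ne]
    · rintro ⟨y, hy⟩
      rw [← hy]
      exact Subtype.ext (D.d_d (D.realizes.ι _ y))

end Res

end Realization

section Operators

open Res

namespace Realizes

variable {k} {P : ZComplex A} {D : Res A k} (R : Realizes k P D) {m n : ℤ}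

lemma π_ι (i : ℤ) (x : P.X i) : D.π i (R.ι i x) = R.ι i x := by
  rw [← R.ι_p, R.p_ι]

lemma ι_injective (i : ℤ) : Function.Injective (R.ι i) :=
  Function.LeftInverse.injective (R.p_ι i)

/-- The graded endomorphism of `P` of degree `n` that is induced by an endomorphism of `D`. -/
def res (n : ℤ) : (D.M →ₗ[A] D.M) →ₗ[k] P.End n where
  toFun F T := R.p T.q ∘ₗ F ∘ₗ R.ι T.p
  map_add' F G := by ext; simp
  map_smul' c F := by
    ext T x
    change R.p T.q (c • F (R.ι T.p x)) = c • R.p T.q (F (R.ι T.p x))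
    rw [LinearMap.map_smul_of_tower]

/-- The graded endomorphism `f` of `P` is induced by the endomorphism `F` of `D`. -/
def Rel (n : ℤ) (f : P.End n) (F : D.M →ₗ[A] D.M) : Prop :=
  ∀ (T : Triplet n) (x : P.X T.p), R.ι T.q (f T x) = F (R.ι T.p x)

variable {R}

lemma Rel.eq_of_right {f g : P.End n} {F : D.M →ₗ[A] D.M} (hf : R.Rel n f F)
    (hg : R.Rel n g F) : f = g :=
  funext fun T => LinearMap.ext fun x => R.ι_injective T.q ((hf T x).trans (hg T x).symm)

variable (R) in
lemma ext_ι {F G : D.M →ₗ[A] D.M} (h : ∀ i x, F (R.ι i x) = G (R.ι i x)) : F = G :=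
  LinearMap.ext fun x => ext_π F G (fun i y => by rw [← R.ι_p, h]) x

lemma Rel.eq_of_left {f : P.End n} {F G : D.M →ₗ[A] D.M} (hF : R.Rel n f F)
    (hG : R.Rel n f G) : F = G :=
  R.ext_ι fun i x => (hF ⟨i, i + n, rfl⟩ x).symm.trans (hG ⟨i, i + n, rfl⟩ x)

lemma Rel.homog {f : P.End n} {F : D.M →ₗ[A] D.M} (hF : R.Rel n f F) : Homog n F := by
  intro i x
  refine ext_π (F ∘ₗ D.π i) (D.π (i + n) ∘ₗ F) (fun j y => ?_) x
  simp only [LinearMap.comp_apply]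
  rw [← R.ι_p j, ← hF ⟨j, j + n, rfl⟩, ← R.π_ι (j + n)]
  by_cases hij : i = j
  · subst hij
    rw [D.π_self, R.π_ι, R.π_ι, ← hF ⟨i, i + n, rfl⟩]
  · rw [D.π_of_ne _ _ (by omega), ← R.π_ι j, D.π_of_ne _ _ hij, map_zero]

lemma rel_res {F : D.M →ₗ[A] D.M} (hF : Homog n F) : R.Rel n (R.res n F) F := by
  rintro ⟨i, _, rfl⟩ x
  change R.ι (i + n) (R.p (i + n) (F (R.ι i x))) = F (R.ι i x)
  rw [R.ι_p, ← hF, R.π_ι]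

variable (R) in
lemma exists_rel (f : P.End n) : ∃ F, R.Rel n f F := by
  refine ⟨asm fun i => R.ι (i + n) ∘ₗ f ⟨i, i + n, rfl⟩ ∘ₗ R.p i, ?_⟩
  rintro ⟨i, _, rfl⟩ x
  dsimp only
  rw [← R.π_ι i x, asm_π, R.π_ι]
  simp [R.p_ι]

lemma Rel.add {f g : P.End n} {F G : D.M →ₗ[A] D.M} (hf : R.Rel n f F) (hg : R.Rel n g G) :
    R.Rel n (f + g) (F + G) := fun T x => by
  simp [hf T x, hg T x]

lemma Rel.smul {f : P.End n} {F : D.M →ₗ[A] D.M} (hf : R.Rel n f F) (c : k) :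
    R.Rel n (c • f) (c • F) := fun T x => by
  simp only [Pi.smul_apply, LinearMap.smul_apply]
  rw [LinearMap.map_smul_of_tower, hf T x]

lemma Rel.zero : R.Rel n 0 0 := fun T x => by simp

lemma Rel.comp {f : P.End m} {g : P.End n} {F G : D.M →ₗ[A] D.M} (hf : R.Rel m f F)
    (hg : R.Rel n g G) : R.Rel (m + n) (P.comp f g) (F ∘ₗ G) := fun T x =>
  (hf ⟨T.p + n, T.q, by have := T.hpq; omega⟩ _).trans (congrArg F (hg ⟨T.p, T.p + n, rfl⟩ x))

lemma ι_xCast {i j : ℤ} (h : i = j) (x : P.X i) : R.ι j (P.xCast h x) = R.ι i x := by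
  subst h; rfl

lemma Rel.one : R.Rel 0 P.one LinearMap.id := fun _ _ => ι_xCast _ _

lemma Rel.delta {f : P.End n} {F : D.M →ₗ[A] D.M} (hf : R.Rel n f F) :
    R.Rel (n + 1) (P.delta f) (D.d ∘ₗ F - (n.negOnePow : ℤ) • F ∘ₗ D.d) := fun T x => by
  simp only [ZComplex.delta, LinearMap.sub_apply, LinearMap.smul_apply, LinearMap.comp_apply,
    map_sub, map_zsmul]
  rw [R.ι_d, hf ⟨T.p, T.p + n, rfl⟩, hf ⟨T.p + 1, T.q, _⟩, R.ι_d]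

lemma Rel.mem_cocycles {f : P.End n} {F : D.M →ₗ[A] D.M} (hf : R.Rel n f F) :
    f ∈ ZComplex.cocycles k P n ↔ Cocycle n F := by
  change P.delta f = 0 ↔ _
  refine ⟨fun h => ⟨hf.homog, fun x => ?_⟩, fun h => Rel.eq_of_right hf.delta ?_⟩
  · have := hf.delta.eq_of_left (h ▸ Rel.zero)
    exact sub_eq_zero.mp (LinearMap.congr_fun this x)
  · convert Rel.zero (R := R) using 1
    ext x
    exact sub_eq_zero.mpr (h.d_apply x)

lemma Rel.mem_boundaries {f : P.End n} {F : D.M →ₗ[A] D.M} (hf : R.Rel n f F) :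
    f ∈ ZComplex.boundaries k P n ↔ Bd n F := by
  have hn : ((n - 1).negOnePow : ℤ) = -(n.negOnePow : ℤ) := by simp [Int.negOnePow_sub]
  constructor
  · rintro ⟨g, hg⟩
    obtain ⟨h, hh⟩ := R.exists_rel g
    refine ⟨h, hh.homog, LinearMap.congr_fun (g := D.d ∘ₗ h + (n.negOnePow : ℤ) • h ∘ₗ D.d)
      (R.ext_ι fun i x => ?_)⟩
    have := hh.delta ⟨i, i + n, by omega⟩ x
    rw [← hg ⟨i, i + n, rfl⟩, hf ⟨i, i + n, rfl⟩] at this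
    simpa [hn] using this
  · rintro ⟨h, hh, e⟩
    refine ⟨R.res (n - 1) h, fun T => LinearMap.ext fun x => R.ι_injective _ ?_⟩
    have := (R.rel_res hh).delta ⟨T.p, T.q, by have := T.hpq; omega⟩ x
    rw [hf T x, this, e]
    simp only [hn, neg_smul, sub_neg_eq_add]
    rfl

end Realizes

lemma ZComplex.extClass_eq_zero_iff {k : Type u} [Field k] [HopfAlgebra k A] {P : ZComplex A}
    {n : ℤ} (f : ZComplex.cocycles k P n) :
    ZComplex.extClass k P n f = 0 ↔ (f : P.End n) ∈ ZComplex.boundaries k P n :=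
  Submodule.Quotient.mk_eq_zero _

lemma ZComplex.extClass_surjective {k : Type u} [Field k] [HopfAlgebra k A] (P : ZComplex A)
    (n : ℤ) : Function.Surjective (ZComplex.extClass k P n) :=
  Submodule.mkQ_surjective _

end Operators

section Formality

open Res MvPolynomial

variable {k}

lemma exists_algHom_of_commute {σ R : Type*} [Ring R] [Algebra k R] (F : σ → R)
    (hF : ∀ i j, F i * F j = F j * F i) :
    ∃ ev : MvPolynomial σ k →ₐ[k] R, ∀ i, ev (X i) = F i := by
  have hcomm : ∀ a ∈ Set.range F, ∀ b ∈ Set.range F, a * b = b * a := by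
    rintro _ ⟨i, rfl⟩ _ ⟨j, rfl⟩
    exact hF i j
  have := Algebra.isMulCommutative_adjoin k hcomm
  let : CommRing (Algebra.adjoin k (Set.range F)) :=
    { (inferInstance : Ring (Algebra.adjoin k (Set.range F))) with
      mul_comm := fun a b => mul_comm' a b }
  exact ⟨(Algebra.adjoin k (Set.range F)).val.comp
    (aeval (S₁ := Algebra.adjoin k (Set.range F))
      fun i => ⟨F i, Algebra.subset_adjoin ⟨i, rfl⟩⟩), fun i => by simp⟩

namespace Res

variable {D D' D'' : Res A k} {n : ℤ} {F G : D.M →ₗ[A] D'.M}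

lemma Homog.smul (hF : Homog n F) (c : k) : Homog n (c • F) := fun i x => by
  simp only [LinearMap.smul_apply, hF i x, LinearMap.map_smul_of_tower]

lemma Cocycle.add (hF : Cocycle n F) (hG : Cocycle n G) : Cocycle n (F + G) :=
  ⟨hF.homog.add hG.homog, fun x => by simp [hF.d_apply, hG.d_apply]⟩

lemma Cocycle.smul (hF : Cocycle n F) (c : k) : Cocycle n (c • F) :=
  ⟨hF.homog.smul c, fun x => by
    simp only [LinearMap.smul_apply, LinearMap.map_smul_of_tower, hF.d_apply]
    rw [smul_comm]⟩

lemma Cocycle.zero : Cocycle n (0 : D.M →ₗ[A] D'.M) := ⟨Homog.zero, by simp⟩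

lemma Bd.smul (hF : Bd n F) (c : k) : Bd n (c • F) := by
  obtain ⟨h, hh, e⟩ := hF
  refine ⟨c • h, hh.smul c, fun x => ?_⟩
  simp only [LinearMap.smul_apply, LinearMap.map_smul_of_tower, e, smul_add]
  rw [smul_comm c]

lemma Bd.comp_isAug {F : D'.M →ₗ[A] D''.M} {φ : D.M →ₗ[A] D'.M} (hF : Bd n F) (hφ : IsAug φ) :
    Bd n (F ∘ₗ φ) := by
  simpa using hF.comp_cocycle hφ.cocycle

lemma IsAug.comp_bd {φ : D'.M →ₗ[A] D''.M} (hφ : IsAug φ) (hF : Bd n F) : Bd n (φ ∘ₗ F) := by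
  simpa using Bd.cocycle_comp hφ.cocycle hF

lemma IsAug.bd_comp_sub {φ : D'.M →ₗ[A] D'.M} (hφ : IsAug φ) (hF : Cocycle n F) :
    Bd n (φ ∘ₗ F - F) := by
  simpa [LinearMap.sub_comp] using (hφ.bd_sub IsAug.id).comp_cocycle hF

lemma IsAug.bd_sub_comp {φ : D.M →ₗ[A] D.M} (hφ : IsAug φ) (hF : Cocycle n F) :
    Bd n (F ∘ₗ φ - F) := by
  simpa [LinearMap.comp_sub] using Bd.cocycle_comp hF (hφ.bd_sub IsAug.id)

end Res

variable {P : ZComplex A} {D₀ : Res A k} {σ : Type*} {w : σ → ℤ}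

/-- The operator `F` is a cocycle whose class corresponds to the polynomial `p` under `e`. -/
def Represents (R : Realizes k P D₀)
    (e : ∀ n : ℤ, ZComplex.ExtGrp k P n ≃ₗ[k] weightedHomogeneousSubmodule k w n)
    (n : ℤ) (F : D₀.M →ₗ[A] D₀.M) (p : MvPolynomial σ k) : Prop :=
  ∃ f : ZComplex.cocycles k P n, R.Rel n f F ∧ (e n (ZComplex.extClass k P n f)).1 = p

namespace Represents

variable {R : Realizes k P D₀}
  {e : ∀ n : ℤ, ZComplex.ExtGrp k P n ≃ₗ[k] weightedHomogeneousSubmodule k w n} {n : ℤ}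
  {F G : D₀.M →ₗ[A] D₀.M} {p q : MvPolynomial σ k}

lemma cocycle (h : Represents R e n F p) : Cocycle n F := by
  obtain ⟨f, hf, -⟩ := h
  exact hf.mem_cocycles.mp f.2

lemma mem (h : Represents R e n F p) : p ∈ weightedHomogeneousSubmodule k w n := by
  obtain ⟨f, -, rfl⟩ := h
  exact (e n _).2

variable (R e) in
lemma exists_left (hp : p ∈ weightedHomogeneousSubmodule k w n) :
    ∃ F, Represents R e n F p := by
  obtain ⟨f, hf⟩ := ZComplex.extClass_surjective P n ((e n).symm ⟨p, hp⟩)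
  obtain ⟨F, hF⟩ := R.exists_rel f.1
  exact ⟨F, f, hF, by simp [hf]⟩

variable (R e) in
lemma exists_right (hF : Cocycle n F) : ∃ p, Represents R e n F p :=
  have h := R.rel_res hF.homog
  ⟨_, ⟨R.res n F, h.mem_cocycles.mpr hF⟩, h, rfl⟩

lemma add (hF : Represents R e n F p) (hG : Represents R e n G q) :
    Represents R e n (F + G) (p + q) := by
  obtain ⟨f, hf, rfl⟩ := hF
  obtain ⟨g, hg, rfl⟩ := hG
  exact ⟨f + g, hf.add hg, by simp⟩

lemma smul (hF : Represents R e n F p) (c : k) : Represents R e n (c • F) (c • p) := by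
  obtain ⟨f, hf, rfl⟩ := hF
  exact ⟨c • f, hf.smul c, by simp⟩

lemma sub (hF : Represents R e n F p) (hG : Represents R e n G q) :
    Represents R e n (F - G) (p - q) := by
  simpa [sub_eq_add_neg] using hF.add (hG.smul (-1))

lemma zero : Represents R e n 0 0 := ⟨0, Realizes.Rel.zero, by simp⟩

lemma eq_zero_iff (h : Represents R e n F p) : p = 0 ↔ Bd n F := by
  obtain ⟨f, hf, rfl⟩ := h
  rw [← hf.mem_boundaries, ← ZComplex.extClass_eq_zero_iff, ZeroMemClass.coe_eq_zero,
    LinearEquiv.map_eq_zero_iff]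

end Represents

/-- A family of commuting cocycles that lift the generators of the Ext-algebra lifts every
homogeneous element of the Ext-algebra. -/
lemma exists_represents {R : Realizes k P D₀}
    {e : ∀ n : ℤ, ZComplex.ExtGrp k P n ≃ₗ[k] weightedHomogeneousSubmodule k w n}
    (he_one : Represents R e 0 LinearMap.id 1)
    (he_mul : ∀ m n F G p q, Represents R e m F p → Represents R e n G q →
      Represents R e (m + n) (F ∘ₗ G) (p * q))
    {D : Res A k} {φ : D.M →ₗ[A] D₀.M}
    (ev : MvPolynomial σ k →ₐ[k] Module.End A D.M) (Y : σ → D₀.M →ₗ[A] D₀.M)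
    (hY : ∀ i, Represents R e (w i) (Y i) (X i)) (hev : ∀ i, Cocycle (w i) (ev (X i)))
    (hφY : ∀ i, Bd (w i) (φ ∘ₗ ev (X i) - Y i ∘ₗ φ)) {n : ℤ} {p : MvPolynomial σ k}
    (hp : p ∈ weightedHomogeneousSubmodule k w n) :
    Cocycle n (ev p) ∧ ∃ Z, Represents R e n Z p ∧ Bd n (φ ∘ₗ ev p - Z ∘ₗ φ) := by
  let T : ℤ → MvPolynomial σ k → Prop := fun n p =>
    Cocycle n (ev p) ∧ ∃ Z, Represents R e n Z p ∧ Bd n (φ ∘ₗ ev p - Z ∘ₗ φ)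
  have zero : ∀ n, T n 0 := fun n =>
    ⟨by rw [map_zero]; exact Cocycle.zero, 0, Represents.zero, by
      rw [map_zero]; simpa using Bd.zero⟩
  have T_add : ∀ n p q, T n p → T n q → T n (p + q) := by
    rintro n p q ⟨hp, Z, hZ, hb⟩ ⟨hq, Z', hZ', hb'⟩
    refine ⟨by rw [map_add]; exact hp.add hq, Z + Z', hZ.add hZ', ?_⟩
    convert hb.add hb' using 1
    rw [map_add, LinearMap.comp_add, LinearMap.add_comp]
    abel
  have smul : ∀ n p (c : k), T n p → T n (c • p) := by
    rintro n p c ⟨hp, Z, hZ, hb⟩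
    refine ⟨by rw [map_smul]; exact hp.smul c, c • Z, hZ.smul c, ?_⟩
    convert hb.smul c using 1
    rw [map_smul, smul_sub]
    ext x
    simp only [LinearMap.sub_apply, LinearMap.comp_apply, LinearMap.smul_apply,
      LinearMap.map_smul_of_tower]
  have one : T 0 1 :=
    ⟨by rw [map_one]; exact IsAug.id.cocycle, LinearMap.id, he_one, by
      rw [map_one]; simpa [Module.End.one_eq_id] using Bd.zero⟩
  have mul : ∀ m n p q, T m p → T n q → T (m + n) (p * q) := by
    rintro m n p q ⟨hp, Z, hZ, hb⟩ ⟨hq, Z', hZ', hb'⟩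
    refine ⟨by rw [map_mul]; exact hp.comp hq, Z ∘ₗ Z', he_mul _ _ _ _ _ _ hZ hZ', ?_⟩
    convert (hb.comp_cocycle hq).add (Bd.cocycle_comp hZ.cocycle hb') using 1
    rw [map_mul, Module.End.mul_eq_comp, LinearMap.sub_comp, LinearMap.comp_sub]
    simp only [LinearMap.comp_assoc]
    abel
  have pow : ∀ i (j : ℕ), T (j • w i) (X i ^ j) := fun i j => by
    induction j with
    | zero => simpa using one
    | succ j ih => rw [succ_nsmul, pow_succ]; exact mul _ _ _ _ ih ⟨hev i, Y i, hY i, hφY i⟩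
  have mono : ∀ s : σ →₀ ℕ, T (Finsupp.weight w s) (monomial s 1) := fun s => by
    induction s using Finsupp.induction_linear with
    | zero => simpa using one
    | add s t hs ht =>
      rw [map_add, ← one_mul (1 : k), ← monomial_mul]
      exact mul _ _ _ _ hs ht
    | single i j =>
      rw [Finsupp.weight_single, ← X_pow_eq_monomial]
      exact pow i j
  change T n p
  rw [p.as_sum]
  refine Finset.sum_induction _ (T n) (T_add n) (zero n) fun s hs => ?_
  have : Finsupp.weight w s = n := hp (mem_support_iff.mp hs)
  rw [← mul_one (coeff s p), ← smul_eq_mul, ← smul_monomial, ← this]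
  exact smul _ _ _ (mono s)

end Formality

/-- If the Yoneda Ext-algebra `Ext•_a(k_a, k_a)` of the
trivial module over a Hopf algebra `a` is a free commutative (polynomial)
algebra on finitely many homogeneous generators of even positive degree, then
the dg-algebra `REnd_a(k_a)` is formal: there exist a projective resolution
`P` of `k_a` and a graded subalgebra `C` of `End•_a(P)` consisting entirely of
cocycles such that taking cohomology classes restricts to an isomorphism of
graded `k`-algebras `C ≅ Ext•_a(k_a, k_a)`. -/
theorem statement7
    -- `Ext•` is computed from some projective resolution `(P₀, ε₀)` of `k_a`:
    (P₀ : ZComplex A) (ε₀ : P₀.X 0 →ₗ[A] TrivMod k A)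
    (hres₀ : IsTrivResolution k P₀ ε₀)
    -- hypothesis: a graded `k`-algebra isomorphism
    -- `Ext• ≅ k[x₁,…,x_N]`, `deg xᵢ = w i` even and positive:
    (N : ℕ) (w : Fin N → ℤ) (hw : ∀ i, Even (w i) ∧ 0 < w i)
    (e : ∀ n : ℤ, ZComplex.ExtGrp k P₀ n ≃ₗ[k]
      ↥(MvPolynomial.weightedHomogeneousSubmodule k w n))
    (he_one : ∀ u : ↥(ZComplex.cocycles k P₀ 0), (u : P₀.End 0) = P₀.one →
      ((e 0 (ZComplex.extClass k P₀ 0 u) : MvPolynomial (Fin N) k) = 1))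
    (he_mul : ∀ (m n : ℤ) (f : ↥(ZComplex.cocycles k P₀ m))
        (g : ↥(ZComplex.cocycles k P₀ n)) (fg : ↥(ZComplex.cocycles k P₀ (m + n))),
      (fg : P₀.End (m + n)) = P₀.comp (f : P₀.End m) (g : P₀.End n) →
      ((e (m + n) (ZComplex.extClass k P₀ (m + n) fg) : MvPolynomial (Fin N) k)
        = (e m (ZComplex.extClass k P₀ m f) : MvPolynomial (Fin N) k)
          * (e n (ZComplex.extClass k P₀ n g) : MvPolynomial (Fin N) k))) :
    -- conclusion: formality of `REnd_a(k_a)`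
    ∃ (P : ZComplex A) (ε : P.X 0 →ₗ[A] TrivMod k A),
      IsTrivResolution k P ε ∧
      ∃ (C : ∀ n : ℤ, Submodule k (P.End n))
        (hle : ∀ n : ℤ, C n ≤ ZComplex.cocycles k P n),
        -- `C` is a graded subalgebra of `End•_a(P)` consisting of cocycles:
        P.one ∈ C 0 ∧
        (∀ (m n : ℤ) (f : P.End m) (g : P.End n),
          f ∈ C m → g ∈ C n → P.comp f g ∈ C (m + n)) ∧
        -- the class map restricts to an isomorphism `C ≅ Ext•`:
        (∀ n : ℤ, Function.Bijective
          ((ZComplex.extClass k P n) ∘ₗ Submodule.inclusion (hle n))) := by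
  obtain ⟨D₀, ⟨R₀⟩⟩ := hres₀.exists_realizes
  have rep_one : Represents R₀ e 0 LinearMap.id 1 := by
    have h := Realizes.Rel.one (R := R₀)
    exact ⟨⟨P₀.one, h.mem_cocycles.mpr Res.IsAug.id.cocycle⟩, h, he_one _ rfl⟩
  have rep_mul : ∀ m n F G p q, Represents R₀ e m F p → Represents R₀ e n G q →
      Represents R₀ e (m + n) (F ∘ₗ G) (p * q) := by
    rintro m n F G _ _ ⟨f, hf, rfl⟩ ⟨g, hg, rfl⟩
    have hfg := hf.comp hg
    have hc := (hf.mem_cocycles.mp f.2).comp (hg.mem_cocycles.mp g.2)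
    exact ⟨⟨_, hfg.mem_cocycles.mpr hc⟩, hfg, he_mul m n f g _ rfl⟩
  have hX : ∀ i, MvPolynomial.X i ∈ MvPolynomial.weightedHomogeneousSubmodule k w (w i) :=
    fun i => MvPolynomial.isWeightedHomogeneous_X k w i
  choose Y hY using fun i => Represents.exists_left R₀ e (hX i)
  obtain ⟨D, F, hF, hcomm, hFY⟩ :=
    Res.exists_commuting D₀ N w (fun i => (hw i).1) Y fun i => (hY i).cocycle
  obtain ⟨ev, hev⟩ := exists_algHom_of_commute (k := k) (R := Module.End A D.M) F
    fun i j => LinearMap.ext (hcomm i j)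
  obtain ⟨φ, hφ⟩ := Res.exists_isAug D D₀
  obtain ⟨ψ, hψ⟩ := Res.exists_isAug D₀ D
  have key : ∀ {n p}, p ∈ MvPolynomial.weightedHomogeneousSubmodule k w n →
      Res.Cocycle n (ev p) ∧ ∃ Z, Represents R₀ e n Z p ∧ Res.Bd n (φ ∘ₗ ev p - Z ∘ₗ φ) :=
    exists_represents rep_one rep_mul ev Y hY (fun i => by rw [hev]; exact hF i)
      (fun i => by rw [hev]; exact hFY φ hφ i)
  let R := D.realizes
  have rel : ∀ {n p}, p ∈ MvPolynomial.weightedHomogeneousSubmodule k w n →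
      R.Rel n (R.res n (ev p)) (ev p) := fun hp => Realizes.rel_res (key hp).1.homog
  refine ⟨D.toZComplex, D.augmentation, D.isTrivResolution,
    fun n => (MvPolynomial.weightedHomogeneousSubmodule k w n).map (R.res n ∘ₗ ev.toLinearMap),
    ?_, ⟨1, MvPolynomial.isWeightedHomogeneous_one k w, ?_⟩, ?_, fun n => ⟨?_, ?_⟩⟩
  · rintro n _ ⟨p, hp, rfl⟩
    exact (rel hp).mem_cocycles.mpr (key hp).1
  · refine (rel (MvPolynomial.isWeightedHomogeneous_one k w)).eq_of_right ?_
    rw [map_one]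
    exact Realizes.Rel.one
  · rintro m n _ _ ⟨p, hp, rfl⟩ ⟨q, hq, rfl⟩
    have hpq := MvPolynomial.IsWeightedHomogeneous.mul hp hq
    refine ⟨p * q, hpq, (rel hpq).eq_of_right ?_⟩
    rw [map_mul]
    exact (rel hp).comp (rel hq)
  · rw [injective_iff_map_eq_zero]
    rintro ⟨_, p, hp, rfl⟩ h
    have hb : Res.Bd n (ev p) :=
      (rel hp).mem_boundaries.mp ((ZComplex.extClass_eq_zero_iff _).mp h)
    obtain ⟨-, Z, hZ, hφZ⟩ := key hp
    have hZφ : Res.Bd n (Z ∘ₗ φ) := by simpa using (hφ.comp_bd hb).sub hφZ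
    have hZ0 : Res.Bd n Z := by
      simpa [LinearMap.comp_assoc] using
        (hZφ.comp_isAug hψ).sub ((hφ.comp hψ).bd_sub_comp hZ.cocycle)
    have hp0 := hZ.eq_zero_iff.mpr hZ0
    subst hp0
    exact Subtype.ext (map_zero _)
  · intro y
    obtain ⟨g, rfl⟩ := ZComplex.extClass_surjective _ n y
    obtain ⟨G, hG⟩ := R.exists_rel g.1
    have hGc := hG.mem_cocycles.mp g.2
    have hZc : Res.Cocycle n (φ ∘ₗ G ∘ₗ ψ) := by
      simpa using hφ.cocycle.comp (hGc.comp hψ.cocycle)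
    obtain ⟨p, hZ⟩ := Represents.exists_right R₀ e hZc
    have hp := hZ.mem
    obtain ⟨-, Z, hZ', hφZ⟩ := key hp
    have hsub : Res.Bd n (Z - φ ∘ₗ G ∘ₗ ψ) := (hZ'.sub hZ).eq_zero_iff.mp (sub_self p)
    have hφG : Res.Bd n (φ ∘ₗ ev p - φ ∘ₗ G) := by
      convert (hφZ.add (hsub.comp_isAug hφ)).add
        (hφ.comp_bd ((hψ.comp hφ).bd_sub_comp hGc)) using 1
      simp only [LinearMap.sub_comp, LinearMap.comp_sub, LinearMap.comp_assoc]
      abel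
    have hfin : Res.Bd n (ev p - G) := by
      have h₁ := (hψ.comp hφ).bd_comp_sub (key hp).1
      have h₂ := (hψ.comp hφ).bd_comp_sub hGc
      convert ((hψ.comp_bd hφG).sub h₁).add h₂ using 1
      simp only [LinearMap.comp_sub, LinearMap.comp_assoc]
      abel
    refine ⟨⟨_, p, hp, rfl⟩, ?_⟩
    rw [← sub_eq_zero, LinearMap.comp_apply, ← map_sub, ZComplex.extClass_eq_zero_iff]
    have hrel : R.Rel n (R.res n (ev p) - g.1) (ev p - G) := fun T x => by
      simp [rel hp T x, hG T x]
    exact hrel.mem_boundaries.mpr hfin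

end Stmt7
end
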